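/- arXiv:1905.07338 — 2 statements merged into one kernel-verified Lean document; each statement's English description precedes it below -/
import Mathlib

section
/- Let n ≥ 2, let Ω ⊂ ℝⁿ be a bounded open set with smooth boundary, and let s ∈ ((n−1)/n, 1). Then there exists a constant C = C(n, s, Ω) such that for every f ∈ C^∞(cl(Ω), ℝⁿ) and every φ ∈ C_c^∞(Ω) one has |∫_Ω det(Df) φ dx| ≤ C · [f]_{W^{s,n/s}(Ω)}ⁿ · [φ]_{W^{(1−s)n, 1/(1−s)}(Ω)}. -/
open MeasureTheory Metric Set Filter
open scoped ENNReal NNReal Topology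

noncomputable section

/-- The Gagliardo `W^{s,p}` seminorm of `f` on `U ⊆ ℝⁿ`. -/
def gagliardoSeminorm {F : Type*} [NormedAddCommGroup F]
    (n : ℕ) (s p : ℝ) (U : Set (EuclideanSpace ℝ (Fin n)))
    (f : EuclideanSpace ℝ (Fin n) → F) : ℝ≥0∞ :=
  (∫⁻ x in U, ∫⁻ y in U,
      (‖f x - f y‖₊ : ℝ≥0∞) ^ p / (‖x - y‖₊ : ℝ≥0∞) ^ ((n : ℝ) + s * p)) ^ (1 / p)

/-- A test function on `U`: smooth, compactly supported, with support inside `U`. -/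
def IsTestFunction (n : ℕ) (U : Set (EuclideanSpace ℝ (Fin n)))
    (φ : EuclideanSpace ℝ (Fin n) → ℝ) : Prop :=
  ContDiff ℝ (⊤ : ℕ∞) φ ∧ HasCompactSupport φ ∧ tsupport φ ⊆ U

/-- `Ω` has smooth boundary: it is the sublevel set of a smooth function with
nonvanishing differential on the boundary. -/
def HasSmoothBoundary (n : ℕ) (Ω : Set (EuclideanSpace ℝ (Fin n))) : Prop :=
  ∃ F : EuclideanSpace ℝ (Fin n) → ℝ, ContDiff ℝ (⊤ : ℕ∞) F ∧ Ω = {x | F x < 0} ∧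
    ∀ x ∈ frontier Ω, fderiv ℝ F x ≠ 0

/-- A bounded open set with smooth boundary is the positivity set of a smooth, compactly supported,
`1/2`-Lipschitz function that vanishes to first order on the boundary. -/
theorem HasSmoothBoundary.exists_defining {n : ℕ} {Ω : Set (EuclideanSpace ℝ (Fin n))}
    (hΩo : IsOpen Ω) (hΩb : Bornology.IsBounded Ω) (hΩs : HasSmoothBoundary n Ω) :
    ∃ ρ : EuclideanSpace ℝ (Fin n) → ℝ, ContDiff ℝ (⊤ : ℕ∞) ρ ∧ HasCompactSupport ρ ∧
      LipschitzWith (1 / 2) ρ ∧ (∀ x, x ∈ Ω ↔ 0 < ρ x) ∧ (∀ x ∈ frontier Ω, fderiv ℝ ρ x ≠ 0) := by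
  obtain ⟨F, hF, rfl, hdF⟩ := hΩs
  obtain ⟨R, hR0, hR⟩ := hΩb.subset_closedBall_lt 0 0
  let χ : ContDiffBump (0 : EuclideanSpace ℝ (Fin n)) := ⟨R + 1, R + 2, by linarith, by linarith⟩
  let h : EuclideanSpace ℝ (Fin n) → ℝ := fun x => χ x * F x
  have hh : ContDiff ℝ (⊤ : ℕ∞) h := χ.contDiff.mul hF
  have hhs : HasCompactSupport h := χ.hasCompactSupport.mul_right
  obtain ⟨C, hC⟩ := hh.lipschitzWith_of_hasCompactSupport hhs (by simp)
  let c : ℝ := 1 / (2 * (C + 1))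
  have hc : 0 < c := by positivity
  have hne : ∀ x ∈ closure {x | F x < 0}, h =ᶠ[𝓝 x] F := by
    intro x hx
    have hx' : x ∈ closedBall (0 : EuclideanSpace ℝ (Fin n)) R :=
      closure_minimal hR isClosed_closedBall hx
    have : ball (0 : EuclideanSpace ℝ (Fin n)) (R + 1) ∈ 𝓝 x :=
      isOpen_ball.mem_nhds (by simp at hx' ⊢; linarith)
    filter_upwards [this] with y hy
    have : χ y = 1 := χ.one_of_mem_closedBall (ball_subset_closedBall hy)
    simp [h, this]
  refine ⟨fun x => -c * h x, contDiff_const.mul hh, hhs.mul_left, ?_, ?_, ?_⟩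
  · refine LipschitzWith.of_dist_le_mul fun x y => ?_
    have h1 := hC.dist_le_mul x y
    rw [Real.dist_eq] at h1 ⊢
    rw [← mul_sub, abs_mul, abs_neg, abs_of_pos hc]
    have h2 : c * (C * dist x y) ≤ 1 / 2 * dist x y := by
      rw [← mul_assoc]
      refine mul_le_mul_of_nonneg_right ?_ dist_nonneg
      have hC0 : (0 : ℝ) ≤ C := C.2
      simp only [c]
      rw [div_mul_eq_mul_div, div_le_div_iff₀ (by positivity) (by norm_num)]
      linarith
    push_cast
    exact (mul_le_mul_of_nonneg_left h1 hc.le).trans h2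
  · intro x
    constructor
    · intro hx
      have := (hne x (subset_closure hx)).self_of_nhds
      have hx : F x < 0 := hx
      show 0 < -c * h x
      rw [this]
      nlinarith
    · intro hx
      have h3 : h x < 0 := by nlinarith
      have h4 : (0 : ℝ) ≤ χ x := χ.nonneg
      show F x < 0
      by_contra! h5
      exact absurd h3 (not_lt.2 (mul_nonneg h4 h5))
  · intro x hx
    have h1 : fderiv ℝ (fun x => -c * h x) x = (-c) • fderiv ℝ h x :=
      fderiv_const_mul (hh.differentiable (by simp) x) (-c)
    rw [h1, (hne x (frontier_subset_closure hx)).fderiv_eq]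
    exact smul_ne_zero (neg_ne_zero.2 hc.ne') (hdF x hx)

/-- The standard basis vectors of `ℝⁿ`. -/
abbrev stdVec {n : ℕ} (i : Fin n) : EuclideanSpace ℝ (Fin n) := EuclideanSpace.single i 1

theorem norm_stdVec {n : ℕ} (i : Fin n) : ‖stdVec i‖ = 1 := by simp [stdVec]

theorem continuous_mul_of_tsupport_subset {X : Type*} [TopologicalSpace X] {U : Set X} {a b : X → ℝ}
    (hU : IsOpen U) (ha : Continuous a) (hs : tsupport a ⊆ U) (hb : ContinuousOn b U) :
    Continuous fun x => a x * b x := by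
  refine continuous_of_tsupport fun x hx => ?_
  have hx' : x ∈ U := hs (closure_mono (Function.support_mul_subset_left a b) hx)
  exact ha.continuousAt.mul (hb.continuousAt (hU.mem_nhds hx'))

theorem integrable_mul_of_tsupport_subset {n : ℕ} {U : Set (EuclideanSpace ℝ (Fin n))}
    {a b : EuclideanSpace ℝ (Fin n) → ℝ} (hU : IsOpen U) (ha : Continuous a)
    (hac : HasCompactSupport a) (hs : tsupport a ⊆ U) (hb : ContinuousOn b U) :
    Integrable fun x => a x * b x :=
  (continuous_mul_of_tsupport_subset hU ha hs hb).integrable_of_hasCompactSupport hac.mul_right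

/-- Integration by parts against a vector field defined on an open set. -/
theorem integral_mul_divergence_eq {n : ℕ} {U : Set (EuclideanSpace ℝ (Fin n))}
    {w : EuclideanSpace ℝ (Fin n) → ℝ} {X : Fin n → EuclideanSpace ℝ (Fin n) → ℝ}
    (hU : IsOpen U) (hw : ContDiff ℝ 1 w) (hwc : HasCompactSupport w) (hs : tsupport w ⊆ U)
    (hX : ∀ i, ContDiffOn ℝ 1 (X i) U) :
    ∫ x, w x * ∑ i, fderiv ℝ (X i) x (stdVec i) =
      -∫ x, ∑ i, fderiv ℝ w x (stdVec i) * X i x := by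
  have hdw : ∀ i : Fin n, Continuous fun x => fderiv ℝ w x (stdVec i) := fun i =>
    (hw.continuous_fderiv (by simp)).clm_apply continuous_const
  have hdwc : ∀ i : Fin n, HasCompactSupport fun x => fderiv ℝ w x (stdVec i) := fun i =>
    hwc.fderiv_apply (𝕜 := ℝ) (stdVec i)
  have hdws : ∀ i : Fin n, (tsupport fun x => fderiv ℝ w x (stdVec i)) ⊆ U := fun i =>
    (tsupport_fderiv_apply_subset ℝ (stdVec i)).trans hs
  have hdX : ∀ i, ContinuousOn (fun x => fderiv ℝ (X i) x (stdVec i)) U := fun i =>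
    ((hX i).continuousOn_fderiv_of_isOpen hU le_rfl).clm_apply continuousOn_const
  have i1 : ∀ i, Integrable fun x => w x * fderiv ℝ (X i) x (stdVec i) := fun i =>
    integrable_mul_of_tsupport_subset hU hw.continuous hwc hs (hdX i)
  have i2 : ∀ i, Integrable fun x => fderiv ℝ w x (stdVec i) * X i x := fun i =>
    integrable_mul_of_tsupport_subset hU (hdw i) (hdwc i) (hdws i) (hX i).continuousOn
  have i3 : ∀ i, Integrable fun x => w x * X i x := fun i =>
    integrable_mul_of_tsupport_subset hU hw.continuous hwc hs (hX i).continuousOn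
  simp_rw [Finset.mul_sum]
  rw [integral_finsetSum _ fun i _ => i1 i, integral_finsetSum _ fun i _ => i2 i,
    ← Finset.sum_neg_distrib]
  refine Finset.sum_congr rfl fun i _ => ?_
  refine integral_mul_fderiv_eq_neg_fderiv_mul_of_integrable (i2 i) (i1 i) (i3 i)
    (fun x _ => hw.differentiable (by simp) x) (fun x hx => ?_)
  exact ((hX i).contDiffAt (hU.mem_nhds (hs hx))).differentiableAt (by simp)

/-- Near the boundary the divergence of the singular field `-ρ^(1-n) ∇ρ` dominates, and a multiple
of the position field makes the divergence positive everywhere. -/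
theorem exists_hardy_constants {n : ℕ} (hn : 2 ≤ n) {Ω : Set (EuclideanSpace ℝ (Fin n))}
    (hΩo : IsOpen Ω) (hΩb : Bornology.IsBounded Ω) {ρ : EuclideanSpace ℝ (Fin n) → ℝ}
    (hρ : ContDiff ℝ (⊤ : ℕ∞) ρ) (hΩ : ∀ x, x ∈ Ω ↔ 0 < ρ x)
    (hd : ∀ x ∈ frontier Ω, fderiv ℝ ρ x ≠ 0) (L : EuclideanSpace ℝ (Fin n) → ℝ)
    (hL : Continuous L) :
    ∃ M c : ℝ, 0 ≤ M ∧ 0 < c ∧ ∀ x ∈ Ω,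
      c ≤ ((n : ℝ) - 1) * ∑ i, fderiv ℝ ρ x (stdVec i) ^ 2 - ρ x * L x + M * ρ x ^ n := by
  let g : EuclideanSpace ℝ (Fin n) → ℝ := fun x =>
    ((n : ℝ) - 1) * ∑ i, fderiv ℝ ρ x (stdVec i) ^ 2 - ρ x * L x
  have hn' : (2 : ℝ) ≤ n := by exact_mod_cast hn
  have hdρ : ∀ i : Fin n, Continuous fun x => fderiv ℝ ρ x (stdVec i) := fun i =>
    (hρ.continuous_fderiv (by simp)).clm_apply continuous_const
  have hg : Continuous g :=
    (continuous_const.mul (continuous_finsetSum _ fun i _ => (hdρ i).pow 2)).sub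
      (hρ.continuous.mul hL)
  have hcl : IsCompact (closure Ω) := hΩb.isCompact_closure
  have hpos : ∀ x ∈ closure Ω, 0 ≤ ρ x := fun x hx =>
    closure_minimal (fun y hy => ((hΩ y).1 hy).le) (isClosed_le continuous_const hρ.continuous) hx
  have hfr : ∀ x ∈ closure Ω, x ∉ Ω → 0 < g x := by
    intro x hx hxΩ
    have h0 : ρ x = 0 := le_antisymm (not_lt.1 fun h => hxΩ ((hΩ x).2 h)) (hpos x hx)
    have hne := hd x (by rw [hΩo.frontier_eq]; exact ⟨hx, hxΩ⟩)
    have : 0 < ∑ i, fderiv ℝ ρ x (stdVec i) ^ 2 := by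
      refine lt_of_le_of_ne (Finset.sum_nonneg fun i _ => sq_nonneg _) fun h => hne ?_
      have h' := (Finset.sum_eq_zero_iff_of_nonneg fun i _ => sq_nonneg _).1 h.symm
      have h2 : ∀ i : Fin n, fderiv ℝ ρ x (stdVec i) = 0 := fun i =>
        pow_eq_zero_iff two_ne_zero |>.1 (h' i (Finset.mem_univ i))
      apply ContinuousLinearMap.coe_injective
      refine (EuclideanSpace.basisFun (Fin n) ℝ).toBasis.ext fun i => ?_
      simpa using h2 i
    simp only [g, h0, zero_mul, sub_zero]
    exact mul_pos (by linarith) this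
  have hS : IsCompact (closure Ω ∩ {x | g x ≤ 0}) :=
    hcl.inter_right (isClosed_le hg continuous_const)
  have hSΩ : ∀ x ∈ closure Ω ∩ {x | g x ≤ 0}, 0 < ρ x := by
    rintro x ⟨hx, hgx⟩
    by_contra h
    exact absurd (hfr x hx fun h' => h ((hΩ x).1 h')) (not_lt.2 hgx)
  have hr : ContinuousOn (fun x => g x / ρ x ^ n) (closure Ω ∩ {x | g x ≤ 0}) :=
    hg.continuousOn.div (hρ.continuous.pow n).continuousOn fun x hx => (pow_pos (hSΩ x hx) n).ne'
  obtain ⟨B, hB⟩ := hS.exists_bound_of_continuousOn hr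
  have hM : ∀ x ∈ closure Ω, 0 < g x + (|B| + 1) * ρ x ^ n := by
    intro x hx
    by_cases hgx : g x ≤ 0
    · have h1 := hB x ⟨hx, hgx⟩
      have h2 : 0 < ρ x ^ n := pow_pos (hSΩ x ⟨hx, hgx⟩) n
      rw [Real.norm_eq_abs, abs_div, abs_of_pos h2, div_le_iff₀ h2] at h1
      have h3 := neg_abs_le (g x)
      have h4 := mul_le_mul_of_nonneg_right (le_abs_self B) h2.le
      nlinarith
    · have := pow_nonneg (hpos x hx) n
      have := mul_nonneg (add_nonneg (abs_nonneg B) zero_le_one) this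
      linarith
  have hcont : ContinuousOn (fun x => g x + (|B| + 1) * ρ x ^ n) (closure Ω) :=
    (hg.add (continuous_const.mul (hρ.continuous.pow n))).continuousOn
  obtain ⟨c, hc, hc'⟩ := hcl.exists_forall_le' hcont hM
  exact ⟨|B| + 1, c, by positivity, hc, fun x hx => hc' x (subset_closure hx)⟩

/-- A vector field on `Ω` whose divergence dominates `ρ^(-n)` and whose size is at most
`ρ^(1-n)`. -/
theorem exists_hardy_field {n : ℕ} (hn : 2 ≤ n) {Ω : Set (EuclideanSpace ℝ (Fin n))}
    (hΩo : IsOpen Ω) (hΩb : Bornology.IsBounded Ω) {ρ : EuclideanSpace ℝ (Fin n) → ℝ}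
    (hρ : ContDiff ℝ (⊤ : ℕ∞) ρ) (hρc : HasCompactSupport ρ) (hΩ : ∀ x, x ∈ Ω ↔ 0 < ρ x)
    (hd : ∀ x ∈ frontier Ω, fderiv ℝ ρ x ≠ 0) :
    ∃ (X : Fin n → EuclideanSpace ℝ (Fin n) → ℝ) (c B : ℝ), 0 < c ∧ 0 ≤ B ∧
      (∀ i, ContDiffOn ℝ 1 (X i) Ω) ∧
      (∀ x ∈ Ω, c * ρ x ^ (-(n : ℝ)) ≤ ∑ i, fderiv ℝ (X i) x (stdVec i)) ∧
      ∀ x ∈ Ω, ∀ i, |X i x| ≤ B * ρ x ^ (1 - (n : ℝ)) := by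
  have hn' : (2 : ℝ) ≤ n := by exact_mod_cast hn
  let r : Fin n → EuclideanSpace ℝ (Fin n) → ℝ := fun i x => fderiv ℝ ρ x (stdVec i)
  have hr : ∀ i, ContDiff ℝ 1 (r i) := fun i =>
    (hρ.fderiv_right (m := 1) (by rw [one_add_one_eq_two]; exact WithTop.coe_le_coe.2 le_top)).clm_apply contDiff_const
  let L : EuclideanSpace ℝ (Fin n) → ℝ := fun x => ∑ i, fderiv ℝ (r i) x (stdVec i)
  have hL : Continuous L := continuous_finsetSum _ fun i _ =>
    ((hr i).continuous_fderiv (by simp)).clm_apply continuous_const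
  obtain ⟨M, c, hM, hc, hMc⟩ := exists_hardy_constants hn hΩo hΩb hρ hΩ hd L hL
  obtain ⟨D, hD⟩ := hρc.exists_bound_of_continuous hρ.continuous
  have hrB : ∀ i, ∃ C, ∀ x, ‖r i x‖ ≤ C := fun i =>
    (hρc.fderiv_apply (𝕜 := ℝ) (stdVec i)).exists_bound_of_continuous (hr i).continuous
  choose Cr hCr using hrB
  obtain ⟨R, hR0, hR⟩ := hΩb.subset_closedBall_lt 0 0
  let X : Fin n → EuclideanSpace ℝ (Fin n) → ℝ := fun i x =>
    -(ρ x ^ (1 - (n : ℝ)) * r i x) + M / n * x i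
  have hpow : ∀ x ∈ Ω, HasFDerivAt (fun x => ρ x ^ (1 - (n : ℝ)))
      (((1 - (n : ℝ)) * ρ x ^ (1 - (n : ℝ) - 1)) • fderiv ℝ ρ x) x := fun x hx =>
    (hρ.differentiable (by simp) x).hasFDerivAt.rpow_const (Or.inl ((hΩ x).1 hx).ne')
  have hXd : ∀ x ∈ Ω, ∀ i, fderiv ℝ (X i) x (stdVec i) =
      ρ x ^ (-(n : ℝ)) * (((n : ℝ) - 1) * r i x ^ 2 - ρ x * fderiv ℝ (r i) x (stdVec i)) + M / n := by
    intro x hx i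
    have h1 := ((hpow x hx).mul ((hr i).differentiable (by simp) x).hasFDerivAt).neg
    have h2 : HasFDerivAt (fun x : EuclideanSpace ℝ (Fin n) => M / n * x i)
        ((M / n) • (EuclideanSpace.proj i : EuclideanSpace ℝ (Fin n) →L[ℝ] ℝ)) x :=
      (EuclideanSpace.proj i : EuclideanSpace ℝ (Fin n) →L[ℝ] ℝ).hasFDerivAt.const_mul (M / n)
    have h3 := (h1.add h2).fderiv
    have h4 : fderiv ℝ (X i) x = _ := h3
    have hρx := (hΩ x).1 hx
    have e1 : ρ x ^ (1 - (n : ℝ)) = ρ x ^ (-(n : ℝ)) * ρ x := by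
      rw [show 1 - (n : ℝ) = -(n : ℝ) + 1 by ring, Real.rpow_add hρx, Real.rpow_one]
    rw [h4]
    have e2 : (1 : ℝ) - n - 1 = -n := by ring
    simp [e1, e2, r]
    ring
  refine ⟨X, c, ∑ i, |Cr i| + M / n * R * |D| ^ (n - 1 : ℝ), hc, ?_, ?_, ?_, ?_⟩
  · have := Finset.sum_nonneg fun i (_ : i ∈ Finset.univ) => abs_nonneg (Cr i)
    positivity
  · intro i
    have h1 : ContDiffOn ℝ 1 (fun x => ρ x ^ (1 - (n : ℝ))) Ω :=
      (hρ.of_le (by exact_mod_cast le_top)).contDiffOn.rpow_const_of_ne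
        fun x hx => ((hΩ x).1 hx).ne'
    have h2 : ContDiff ℝ 1 (fun x : EuclideanSpace ℝ (Fin n) => x i) :=
      (EuclideanSpace.proj i : EuclideanSpace ℝ (Fin n) →L[ℝ] ℝ).contDiff
    exact (h1.mul (hr i).contDiffOn).neg.add (contDiff_const.mul h2).contDiffOn
  · intro x hx
    have hρx := (hΩ x).1 hx
    rw [Finset.sum_congr rfl fun i _ => hXd x hx i, Finset.sum_add_distrib, ← Finset.mul_sum,
      Finset.sum_sub_distrib, ← Finset.mul_sum, ← Finset.mul_sum]
    have e3 : ∑ i : Fin n, M / (n : ℝ) = M := by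
      simp
      field_simp
    have e4 : M = ρ x ^ (-(n : ℝ)) * (M * ρ x ^ n) := by
      rw [Real.rpow_neg hρx.le, Real.rpow_natCast]
      field_simp
    rw [e3, e4, ← mul_add, mul_comm c]
    exact mul_le_mul_of_nonneg_left (hMc x hx) (Real.rpow_nonneg hρx.le _)
  · intro x hx i
    have hρx := (hΩ x).1 hx
    have hp : 0 < ρ x ^ (1 - (n : ℝ)) := Real.rpow_pos_of_pos hρx _
    have hxi : |x i| ≤ R := by
      have h1 : ‖x i‖ ≤ ‖x‖ := PiLp.norm_apply_le x i
      have h2 : ‖x‖ ≤ R := by simpa using hR hx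
      exact h1.trans h2
    have h1 : |r i x| ≤ ∑ i, |Cr i| := (hCr i x).trans ((le_abs_self _).trans
      (Finset.single_le_sum (fun i _ => abs_nonneg (Cr i)) (Finset.mem_univ i)))
    have h2 : 1 ≤ |D| ^ ((n : ℝ) - 1) * ρ x ^ (1 - (n : ℝ)) := by
      rw [show 1 - (n : ℝ) = -((n : ℝ) - 1) by ring, Real.rpow_neg hρx.le, ← div_eq_mul_inv,
        one_le_div (Real.rpow_pos_of_pos hρx _)]
      refine Real.rpow_le_rpow hρx.le ?_ (by linarith)
      exact (le_abs_self _).trans ((hD x).trans (le_abs_self D))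
    calc |X i x| ≤ |ρ x ^ (1 - (n : ℝ)) * r i x| + |M / n * x i| := by
          refine (abs_add_le _ _).trans ?_
          rw [abs_neg]
      _ = ρ x ^ (1 - (n : ℝ)) * |r i x| + M / n * |x i| := by
          rw [abs_mul, abs_mul, abs_of_pos hp, abs_of_nonneg (show 0 ≤ M / n by positivity)]
      _ ≤ ρ x ^ (1 - (n : ℝ)) * ∑ i, |Cr i| +
          M / n * R * (|D| ^ ((n : ℝ) - 1) * ρ x ^ (1 - (n : ℝ))) := by
          have h3 : M / n * |x i| ≤ M / n * R := by gcongr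
          have h4 : M / n * R * 1 ≤ M / n * R * (|D| ^ ((n : ℝ) - 1) * ρ x ^ (1 - (n : ℝ))) := by
            gcongr
          have h5 := mul_le_mul_of_nonneg_left h1 hp.le
          linarith
      _ = _ := by ring

/-- **Hardy's inequality**, before the application of Hölder's inequality. -/
theorem exists_hardy_integral {n : ℕ} (hn : 2 ≤ n) {Ω : Set (EuclideanSpace ℝ (Fin n))}
    (hΩo : IsOpen Ω) (hΩb : Bornology.IsBounded Ω) {ρ : EuclideanSpace ℝ (Fin n) → ℝ}
    (hρ : ContDiff ℝ (⊤ : ℕ∞) ρ) (hρc : HasCompactSupport ρ) (hΩ : ∀ x, x ∈ Ω ↔ 0 < ρ x)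
    (hd : ∀ x ∈ frontier Ω, fderiv ℝ ρ x ≠ 0) {p : ℝ} (hp : 1 < p) :
    ∃ C : ℝ, 0 ≤ C ∧ ∀ u : EuclideanSpace ℝ (Fin n) → ℝ, ContDiff ℝ 1 u → HasCompactSupport u →
      tsupport u ⊆ Ω →
      Integrable (fun x => |u x| ^ p * ρ x ^ (-(n : ℝ))) ∧
      Integrable (fun x => |u x| ^ (p - 1) * (ρ x ^ (1 - (n : ℝ)) * ‖fderiv ℝ u x‖)) ∧
      ∫ x, |u x| ^ p * ρ x ^ (-(n : ℝ)) ≤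
        C * ∫ x, |u x| ^ (p - 1) * (ρ x ^ (1 - (n : ℝ)) * ‖fderiv ℝ u x‖) := by
  obtain ⟨X, c, B, hc, hB, hX, hdiv, hXB⟩ := exists_hardy_field hn hΩo hΩb hρ hρc hΩ hd
  refine ⟨n * p * B / c, by positivity, fun u hu huc hus => ?_⟩
  let w : EuclideanSpace ℝ (Fin n) → ℝ := fun x => |u x| ^ p
  have hw : ContDiff ℝ 1 w := hu.norm_rpow hp
  have hwt : tsupport w ⊆ tsupport u := by
    refine closure_mono fun x hx => ?_
    contrapose! hx
    have hx' : u x = 0 := by simpa using hx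
    simp [w, hx', (by linarith : p ≠ 0)]
  have hws : tsupport w ⊆ Ω := hwt.trans hus
  have hwc : HasCompactSupport w := huc.of_isClosed_subset (isClosed_tsupport _) hwt
  have hρp : ∀ q : ℝ, ContinuousOn (fun x => ρ x ^ q) Ω := fun q =>
    hρ.continuous.continuousOn.rpow_const fun x hx => Or.inl ((hΩ x).1 hx).ne'
  have hu1 : Continuous fun x => |u x| ^ (p - 1) :=
    hu.continuous.abs.rpow_const fun x => Or.inr (by linarith)
  have hu1t : (tsupport fun x => |u x| ^ (p - 1)) ⊆ tsupport u := by
    refine closure_mono fun x hx => ?_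
    contrapose! hx
    have hx' : u x = 0 := by simpa using hx
    simp [hx', (by linarith : p - 1 ≠ 0)]
  have i1 : Integrable (fun x => |u x| ^ p * ρ x ^ (-(n : ℝ))) :=
    integrable_mul_of_tsupport_subset hΩo hw.continuous hwc hws (hρp _)
  have i2 : Integrable (fun x => |u x| ^ (p - 1) * (ρ x ^ (1 - (n : ℝ)) * ‖fderiv ℝ u x‖)) :=
    integrable_mul_of_tsupport_subset hΩo hu1 (huc.of_isClosed_subset (isClosed_tsupport _) hu1t)
      (hu1t.trans hus) ((hρp _).mul (hu.continuous_fderiv (by simp)).norm.continuousOn)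
  refine ⟨i1, i2, ?_⟩
  have hdX : ContinuousOn (fun x => ∑ i, fderiv ℝ (X i) x (stdVec i)) Ω :=
    continuousOn_finsetSum _ fun i _ =>
      ((hX i).continuousOn_fderiv_of_isOpen hΩo le_rfl).clm_apply continuousOn_const
  have hw0 : ∀ x, x ∉ Ω → w x = 0 := fun x hx => image_eq_zero_of_notMem_tsupport fun h => hx (hws h)
  have hdw : ∀ x, ∀ i : Fin n, |fderiv ℝ w x (stdVec i)| ≤ p * |u x| ^ (p - 1) * ‖fderiv ℝ u x‖ := by
    intro x i
    have h1 : fderiv ℝ w x = (p * |u x| ^ (p - 2) * u x) • fderiv ℝ u x :=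
      ((hasDerivAt_abs_rpow (u x) hp).comp_hasFDerivAt x
        (hu.differentiable (by simp) x).hasFDerivAt).fderiv
    have h2 : |u x| ^ (p - 2) * |u x| = |u x| ^ (p - 1) := by
      by_cases h0 : u x = 0
      · simp [h0, (by linarith : p - 1 ≠ 0)]
      · rw [show p - 1 = p - 2 + 1 by ring, Real.rpow_add (abs_pos.2 h0), Real.rpow_one]
    have h3 : |fderiv ℝ u x (stdVec i)| ≤ ‖fderiv ℝ u x‖ := by
      simpa [norm_stdVec] using (fderiv ℝ u x).le_opNorm (stdVec i)
    rw [h1, smul_apply, smul_eq_mul, abs_mul, abs_mul, abs_mul, abs_of_pos (by linarith : 0 < p),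
      abs_of_nonneg (Real.rpow_nonneg (abs_nonneg (u x)) _), mul_assoc p, h2]
    gcongr
  have key := integral_mul_divergence_eq hΩo hw hwc hws hX
  have l1 : c * ∫ x, |u x| ^ p * ρ x ^ (-(n : ℝ)) ≤
      ∫ x, w x * ∑ i, fderiv ℝ (X i) x (stdVec i) := by
    rw [← integral_const_mul]
    refine integral_mono (i1.const_mul c)
      (integrable_mul_of_tsupport_subset hΩo hw.continuous hwc hws hdX) fun x => ?_
    by_cases hx : x ∈ Ω
    · have h1 := mul_le_mul_of_nonneg_left (hdiv x hx) (Real.rpow_nonneg (abs_nonneg (u x)) p)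
      simp only [w]
      linarith
    · have h0 := hw0 x hx
      simp only [w] at h0 ⊢
      simp [h0]
  have l2 : -∫ x, ∑ i, fderiv ℝ w x (stdVec i) * X i x ≤
      n * p * B * ∫ x, |u x| ^ (p - 1) * (ρ x ^ (1 - (n : ℝ)) * ‖fderiv ℝ u x‖) := by
    rw [← integral_const_mul]
    refine (neg_le_abs _).trans ?_
    rw [← Real.norm_eq_abs]
    refine norm_integral_le_of_norm_le (i2.const_mul _) ?_
    refine Eventually.of_forall fun x => ?_
    by_cases hx : x ∈ Ω
    · refine (norm_sum_le _ _).trans ?_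
      have h1 : ∀ i ∈ Finset.univ, ‖fderiv ℝ w x (stdVec i) * X i x‖ ≤
          p * B * (|u x| ^ (p - 1) * (ρ x ^ (1 - (n : ℝ)) * ‖fderiv ℝ u x‖)) := by
        intro i _
        rw [norm_mul, Real.norm_eq_abs, Real.norm_eq_abs]
        refine (mul_le_mul (hdw x i) (hXB x hx i) (abs_nonneg _) (by positivity)).trans (le_of_eq ?_)
        ring
      refine (Finset.sum_le_sum h1).trans (le_of_eq ?_)
      simp
      ring
    · have h0 : ∀ i : Fin n, fderiv ℝ w x (stdVec i) = 0 := fun i => by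
        rw [image_eq_zero_of_notMem_tsupport (f := fderiv ℝ w)
          fun h => hx (hws (tsupport_fderiv_subset ℝ h))]
        rfl
      have h1 : u x = 0 := image_eq_zero_of_notMem_tsupport fun h => hx (hus h)
      simp [h0, h1, (by linarith : p - 1 ≠ 0)]
  rw [div_mul_eq_mul_div, le_div_iff₀ hc]
  linarith

/-- **Hardy's inequality** on a smooth bounded domain, in the scaling `ρ^(-n)`. -/
theorem exists_hardy {n : ℕ} (hn : 2 ≤ n) {Ω : Set (EuclideanSpace ℝ (Fin n))}
    (hΩo : IsOpen Ω) (hΩb : Bornology.IsBounded Ω) {ρ : EuclideanSpace ℝ (Fin n) → ℝ}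
    (hρ : ContDiff ℝ (⊤ : ℕ∞) ρ) (hρc : HasCompactSupport ρ) (hΩ : ∀ x, x ∈ Ω ↔ 0 < ρ x)
    (hd : ∀ x ∈ frontier Ω, fderiv ℝ ρ x ≠ 0) {p : ℝ} (hp : 1 < p) :
    ∃ C : ℝ, 0 ≤ C ∧ ∀ u : EuclideanSpace ℝ (Fin n) → ℝ, ContDiff ℝ 1 u → HasCompactSupport u →
      tsupport u ⊆ Ω →
      (∫⁻ x in Ω, ENNReal.ofReal (|u x| ^ p * ρ x ^ (-(n : ℝ)))) ^ (1 / p) ≤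
        ENNReal.ofReal C *
          (∫⁻ x in Ω, ENNReal.ofReal (ρ x ^ (p - n) * ‖fderiv ℝ u x‖ ^ p)) ^ (1 / p) := by
  obtain ⟨C, hC, h⟩ := exists_hardy_integral hn hΩo hΩb hρ hρc hΩ hd hp
  refine ⟨C, hC, fun u hu huc hus => ?_⟩
  obtain ⟨i1, i2, h⟩ := h u hu huc hus
  have hp0 : 0 < p := by linarith
  have hpi : 0 < 1 / p := by positivity
  have hpi1 : 1 / p < 1 := by rw [div_lt_one hp0]; exact hp
  have hu0 : ∀ x, x ∉ Ω → u x = 0 := fun x hx => image_eq_zero_of_notMem_tsupport fun h => hx (hus h)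
  have e1 : ENNReal.ofReal (∫ x, |u x| ^ p * ρ x ^ (-(n : ℝ))) =
      ∫⁻ x in Ω, ENNReal.ofReal (|u x| ^ p * ρ x ^ (-(n : ℝ))) := by
    rw [← setIntegral_eq_integral_of_forall_compl_eq_zero (s := Ω)
      fun x hx => by simp [hu0 x hx, hp0.ne']]
    refine ofReal_integral_eq_lintegral_ofReal i1.integrableOn ?_
    filter_upwards [self_mem_ae_restrict hΩo.measurableSet] with x hx
    have := ((hΩ x).1 hx).le
    simp only [Pi.zero_apply]
    positivity
  have e2 : ENNReal.ofReal (∫ x, |u x| ^ (p - 1) * (ρ x ^ (1 - (n : ℝ)) * ‖fderiv ℝ u x‖)) =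
      ∫⁻ x in Ω, ENNReal.ofReal (|u x| ^ (p - 1) * (ρ x ^ (1 - (n : ℝ)) * ‖fderiv ℝ u x‖)) := by
    rw [← setIntegral_eq_integral_of_forall_compl_eq_zero (s := Ω)
      fun x hx => by simp [hu0 x hx, (by linarith : p - 1 ≠ 0)]]
    refine ofReal_integral_eq_lintegral_ofReal i2.integrableOn ?_
    filter_upwards [self_mem_ae_restrict hΩo.measurableSet] with x hx
    have := ((hΩ x).1 hx).le
    simp only [Pi.zero_apply]
    positivity
  set I := ∫⁻ x in Ω, ENNReal.ofReal (|u x| ^ p * ρ x ^ (-(n : ℝ)))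
  set D := ∫⁻ x in Ω, ENNReal.ofReal (ρ x ^ (p - n) * ‖fderiv ℝ u x‖ ^ p)
  have hI : I ≠ ∞ := e1 ▸ ENNReal.ofReal_ne_top
  have m1 : Measurable fun x => ENNReal.ofReal (|u x| ^ p * ρ x ^ (-(n : ℝ))) :=
    ((hu.continuous.measurable.norm.pow_const p).mul
      (hρ.continuous.measurable.pow_const _)).ennreal_ofReal
  have m2 : Measurable fun x => ENNReal.ofReal (ρ x ^ (p - n) * ‖fderiv ℝ u x‖ ^ p) :=
    ((hρ.continuous.measurable.pow_const _).mul
      ((hu.continuous_fderiv (by simp)).measurable.norm.pow_const p)).ennreal_ofReal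
  have holder : ∫⁻ x in Ω, ENNReal.ofReal (|u x| ^ (p - 1) * (ρ x ^ (1 - (n : ℝ)) * ‖fderiv ℝ u x‖))
      ≤ I ^ (1 - 1 / p) * D ^ (1 / p) := by
    refine le_trans (le_of_eq ?_) (ENNReal.lintegral_mul_norm_pow_le m1.aemeasurable m2.aemeasurable
      (sub_nonneg.2 hpi1.le) hpi.le (by ring))
    refine setLIntegral_congr_fun hΩo.measurableSet fun x hx => ?_
    have hρx := (hΩ x).1 hx
    rw [ENNReal.ofReal_rpow_of_nonneg (by positivity) (by linarith),
      ENNReal.ofReal_rpow_of_nonneg (by positivity) hpi.le, ← ENNReal.ofReal_mul (by positivity)]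
    congr 1
    rw [Real.mul_rpow (by positivity) (by positivity), Real.mul_rpow (by positivity) (by positivity),
      ← Real.rpow_mul (abs_nonneg _), ← Real.rpow_mul hρx.le, ← Real.rpow_mul hρx.le,
      ← Real.rpow_mul (norm_nonneg _), mul_one_div_cancel hp0.ne', Real.rpow_one,
      show p * (1 - 1 / p) = p - 1 by field_simp,
      show 1 - (n : ℝ) = -(n : ℝ) * (1 - 1 / p) + (p - n) * (1 / p) by field_simp; ring,
      Real.rpow_add hρx]
    ring
  have main : I ≤ ENNReal.ofReal C * (I ^ (1 - 1 / p) * D ^ (1 / p)) := by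
    refine le_trans ?_ (mul_le_mul_right holder _)
    rw [← e1, ← e2, ← ENNReal.ofReal_mul hC]
    exact ENNReal.ofReal_le_ofReal h
  by_cases hI0 : I = 0
  · simp [hI0, hp0]
  have hq0 : I ^ (1 - 1 / p) ≠ 0 := by
    simp [ENNReal.rpow_eq_zero_iff, hI0, hI]
  have hqt : I ^ (1 - 1 / p) ≠ ∞ := ENNReal.rpow_ne_top_of_nonneg (by linarith) hI
  refine (ENNReal.mul_le_mul_iff_right hq0 hqt).1 ?_
  rw [← ENNReal.rpow_add _ _ hI0 hI, sub_add_cancel, ENNReal.rpow_one]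
  exact main.trans (le_of_eq (by ring))

/-- The derivative of a product `Φ ∏ dGᵢ(vᵢ)` in a direction. -/
theorem fderiv_mul_prod_apply {V : Type*} [NormedAddCommGroup V] [NormedSpace ℝ V] {n : ℕ}
    {Φ : V → ℝ} {G : Fin n → V → ℝ} (hΦ : ContDiff ℝ 2 Φ) (hG : ∀ i, ContDiff ℝ 2 (G i))
    (w : Fin n → V) (v y : V) :
    fderiv ℝ (fun y => Φ y * ∏ i, fderiv ℝ (G i) y (w i)) y v =
      fderiv ℝ Φ y v * ∏ i, fderiv ℝ (G i) y (w i) +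
        Φ y * ∑ k, (∏ i ∈ Finset.univ.erase k, fderiv ℝ (G i) y (w i)) *
          fderiv ℝ (fderiv ℝ (G k)) y v (w k) := by
  have h1 : ∀ i ∈ (Finset.univ : Finset (Fin n)), HasFDerivAt (fun y => fderiv ℝ (G i) y (w i))
      ((ContinuousLinearMap.apply ℝ ℝ (w i)).comp (fderiv ℝ (fderiv ℝ (G i)) y)) y := fun i _ =>
    (ContinuousLinearMap.apply ℝ ℝ (w i)).hasFDerivAt.comp y
      (((hG i).fderiv_right (m := 1) (by norm_num)).differentiable (by simp) y).hasFDerivAt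
  have h2 := (hΦ.differentiable (by simp) y).hasFDerivAt.mul (HasFDerivAt.finsetProd h1)
  refine (DFunLike.congr_fun h2.fderiv v).trans ?_
  simp [mul_comm, add_comm]

/-- The exterior derivative of `Φ dG₁ ∧ ⋯ ∧ dGₙ` is the determinant of `(Φ, G)`. -/
theorem sum_perm_fderiv_eq_det {V : Type*} [NormedAddCommGroup V] [NormedSpace ℝ V] {n : ℕ}
    {Φ : V → ℝ} {G : Fin n → V → ℝ} (hΦ : ContDiff ℝ 2 Φ) (hG : ∀ i, ContDiff ℝ 2 (G i))
    (b : Fin (n + 1) → V) (y : V) :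
    ∑ σ : Equiv.Perm (Fin (n + 1)), ((Equiv.Perm.sign σ : ℤ) : ℝ) *
        fderiv ℝ (fun y => Φ y * ∏ i, fderiv ℝ (G i) y (b (σ i.succ))) y (b (σ 0)) =
      Matrix.det (Matrix.of fun j i => fderiv ℝ ((Fin.cons Φ G : Fin (n + 1) → V → ℝ) i) y (b j)) := by
  rw [Matrix.det_apply']
  simp only [Matrix.of_apply, Fin.prod_univ_succ, Fin.cons_zero, Fin.cons_succ, fderiv_mul_prod_apply hΦ hG, mul_add,
    Finset.sum_add_distrib]
  refine add_eq_left.2 ?_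
  simp only [Finset.mul_sum]
  rw [Finset.sum_comm]
  refine Finset.sum_eq_zero fun k _ => ?_
  refine Finset.sum_involution (fun σ _ => σ * Equiv.swap 0 k.succ) (fun σ _ => ?_)
    (fun σ _ _ h => ?_) (fun _ _ => Finset.mem_univ _) fun σ _ => ?_
  · have hsymm : fderiv ℝ (fderiv ℝ (G k)) y (b (σ 0)) (b (σ k.succ)) =
        fderiv ℝ (fderiv ℝ (G k)) y (b (σ k.succ)) (b (σ 0)) :=
      ((hG k).contDiffAt.isSymmSndFDerivAt (by simp)) _ _
    have hprod : ∏ i ∈ Finset.univ.erase k,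
        fderiv ℝ (G i) y (b ((σ * Equiv.swap 0 k.succ) i.succ)) =
        ∏ i ∈ Finset.univ.erase k, fderiv ℝ (G i) y (b (σ i.succ)) := by
      refine Finset.prod_congr rfl fun i hi => ?_
      rw [Equiv.Perm.mul_apply, Equiv.swap_apply_of_ne_of_ne (Fin.succ_ne_zero i)
        fun h => (Finset.mem_erase.1 hi).1 (Fin.succ_injective n h)]
    rw [hprod, Equiv.Perm.sign_mul, Equiv.Perm.sign_swap (Fin.succ_ne_zero k).symm,
      Equiv.Perm.mul_apply, Equiv.Perm.mul_apply, Equiv.swap_apply_left, Equiv.swap_apply_right,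
      hsymm]
    push_cast
    ring
  · have h' : Equiv.swap 0 k.succ = 1 := mul_left_cancel (a := σ) (by rw [h, mul_one])
    exact (Fin.succ_ne_zero k).symm (Equiv.swap_eq_one_iff.1 h')
  · rw [mul_assoc, Equiv.swap_mul_self, mul_one]

section Slab

variable {n : ℕ} {h : ℝ × EuclideanSpace ℝ (Fin n) → ℝ} {K : Set (EuclideanSpace ℝ (Fin n))}

theorem fderiv_eq_zero_of_slab (hK : IsCompact K)
    (hz : ∀ t ∈ Ioo (-(3 / 2) : ℝ) (3 / 2), ∀ x ∉ K, h (t, x) = 0) {t : ℝ}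
    (ht : t ∈ Ioo (-(3 / 2) : ℝ) (3 / 2)) {x : EuclideanSpace ℝ (Fin n)} (hx : x ∉ K) :
    fderiv ℝ h (t, x) = 0 := by
  have : h =ᶠ[𝓝 (t, x)] fun _ => 0 := by
    have ho : IsOpen (Ioo (-(3 / 2) : ℝ) (3 / 2) ×ˢ Kᶜ) := isOpen_Ioo.prod hK.isClosed.isOpen_compl
    filter_upwards [ho.mem_nhds ⟨ht, hx⟩] with p hp
    exact hz p.1 hp.1 p.2 hp.2
  rw [this.fderiv_eq]
  simp

theorem integrable_integral_of_slab {g : ℝ × EuclideanSpace ℝ (Fin n) → ℝ} (hg : Continuous g)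
    (hK : IsCompact K) (hz : ∀ t ∈ Ioo (-(3 / 2) : ℝ) (3 / 2), ∀ x ∉ K, g (t, x) = 0) :
    Integrable fun x => ∫ t in (0 : ℝ)..1, g (t, x) := by
  refine Continuous.integrable_of_hasCompactSupport ?_ (HasCompactSupport.intro hK fun x hx => ?_)
  · exact intervalIntegral.continuous_parametric_intervalIntegral_of_continuous'
      (f := fun x t => g (t, x)) (by fun_prop) 0 1
  · refine (intervalIntegral.integral_congr fun t ht => ?_).trans intervalIntegral.integral_zero
    rw [uIcc_of_le zero_le_one] at ht
    exact hz t ⟨by linarith [ht.1], by linarith [ht.2]⟩ x hx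

theorem integral_integral_fderiv_snd_eq_zero (hh : ContDiff ℝ 1 h) (hK : IsCompact K)
    (hz : ∀ t ∈ Ioo (-(3 / 2) : ℝ) (3 / 2), ∀ x ∉ K, h (t, x) = 0) (v : EuclideanSpace ℝ (Fin n)) :
    ∫ x, ∫ t in (0 : ℝ)..1, fderiv ℝ h (t, x) (0, v) = 0 := by
  have hc : Continuous fun p => fderiv ℝ h p (0, v) :=
    (hh.continuous_fderiv (by simp)).clm_apply continuous_const
  have hz' : ∀ t ∈ Ioo (-(3 / 2) : ℝ) (3 / 2), ∀ x ∉ K, fderiv ℝ h (t, x) (0, v) = 0 :=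
    fun t ht x hx => by simp [fderiv_eq_zero_of_slab hK hz ht hx]
  simp only [intervalIntegral.integral_of_le zero_le_one]
  rw [integral_integral_swap (f := fun x t => fderiv ℝ h (t, x) (0, v))]
  · refine (setIntegral_congr_fun measurableSet_Ioc fun t ht => ?_).trans (integral_zero _ _)
    have ht' : t ∈ Ioo (-(3 / 2) : ℝ) (3 / 2) := ⟨by linarith [ht.1], by linarith [ht.2]⟩
    have hcs : HasCompactSupport fun x => h (t, x) := HasCompactSupport.intro hK (hz t ht')
    have hd : ∀ x, HasFDerivAt (fun x => h (t, x))
        ((fderiv ℝ h (t, x)).comp (ContinuousLinearMap.inr ℝ ℝ _)) x := fun x =>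
      (hh.differentiable (by simp) (t, x)).hasFDerivAt.comp x (hasFDerivAt_prodMk_right t x)
    have he : (fun x => fderiv ℝ h (t, x) (0, v)) = fun x => fderiv ℝ (fun x => h (t, x)) x v := by
      ext x; rw [(hd x).fderiv]; simp
    have hcd : ContDiff ℝ 1 fun x => h (t, x) := hh.comp (contDiff_const.prodMk contDiff_id)
    have hcd' : Continuous fun x => fderiv ℝ (fun x => h (t, x)) x v :=
      (hcd.continuous_fderiv (by simp)).clm_apply continuous_const
    have := integral_mul_fderiv_eq_neg_fderiv_mul_of_integrable (μ := volume)
      (f := fun _ : EuclideanSpace ℝ (Fin n) => (1 : ℝ)) (g := fun x => h (t, x)) (v := v)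
      (by simp)
      (by simpa using hcd'.integrable_of_hasCompactSupport (hcs.fderiv_apply (𝕜 := ℝ) v))
      (by simpa using hcd.continuous.integrable_of_hasCompactSupport hcs)
      (fun x _ => by fun_prop) (fun x _ => (hd x).differentiableAt)
    simpa [he] using this
  · rw [← Measure.restrict_univ (μ := (volume : Measure (EuclideanSpace ℝ (Fin n)))),
      Measure.prod_restrict]
    refine IntegrableOn.of_forall_sdiff_eq_zero (s := K ×ˢ Icc (0 : ℝ) 1) ?_
      (MeasurableSet.univ.prod measurableSet_Ioc) ?_ 
    · exact ContinuousOn.integrableOn_compact (hK.prod isCompact_Icc)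
        (hc.comp continuous_swap).continuousOn
    · rintro ⟨x, t⟩ ⟨⟨-, ht⟩, hn⟩
      have hx : x ∉ K := fun hx => hn ⟨hx, Ioc_subset_Icc_self ht⟩
      exact hz' t ⟨by linarith [ht.1], by linarith [ht.2]⟩ x hx

theorem integral_integral_fderiv_fst_eq (hh : ContDiff ℝ 1 h) (hK : IsCompact K)
    (hz : ∀ t ∈ Ioo (-(3 / 2) : ℝ) (3 / 2), ∀ x ∉ K, h (t, x) = 0) :
    ∫ x, ∫ t in (0 : ℝ)..1, fderiv ℝ h (t, x) (1, 0) = (∫ x, h (1, x)) - ∫ x, h (0, x) := by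
  have hi : ∀ t ∈ Ioo (-(3 / 2) : ℝ) (3 / 2), Integrable fun x => h (t, x) := fun t ht =>
    (hh.continuous.comp (by fun_prop : Continuous fun x => (t, x))).integrable_of_hasCompactSupport
      (HasCompactSupport.intro hK (hz t ht))
  rw [← integral_sub (hi 1 (by norm_num)) (hi 0 (by norm_num))]
  congr 1
  ext x
  refine intervalIntegral.integral_eq_sub_of_hasDerivAt (f := fun t => h (t, x)) (fun t _ => ?_) ?_
  · have := (hh.differentiable (by simp) (t, x)).hasFDerivAt.comp_hasDerivAt t
      ((hasDerivAt_id t).prodMk (hasDerivAt_const t x))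
    exact this
  · exact ((hh.continuous_fderiv (by simp)).comp
      (by fun_prop : Continuous fun t : ℝ => (t, x))).clm_apply continuous_const
      |>.intervalIntegrable _ _

/-- The coordinate frame of `ℝ × ℝⁿ`, time direction first. -/
def slabFrame {n : ℕ} : Fin (n + 1) → ℝ × EuclideanSpace ℝ (Fin n) :=
  Fin.cons (1, 0) fun i => (0, stdVec i)

/-- **Stokes' theorem** for `Φ dG₁ ∧ ⋯ ∧ dGₙ` on the slab `[0, 1] × ℝⁿ`. -/
theorem integral_det_slab {Φ : ℝ × EuclideanSpace ℝ (Fin n) → ℝ}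
    {G : Fin n → ℝ × EuclideanSpace ℝ (Fin n) → ℝ}
    (hΦ : ContDiff ℝ 2 Φ) (hG : ∀ i, ContDiff ℝ 2 (G i)) (hK : IsCompact K)
    (hz : ∀ t ∈ Ioo (-(3 / 2) : ℝ) (3 / 2), ∀ x ∉ K, Φ (t, x) = 0) :
    ∫ x, ∫ t in (0 : ℝ)..1, Matrix.det (Matrix.of fun j i =>
        fderiv ℝ ((Fin.cons Φ G : Fin (n + 1) → _ → ℝ) i) (t, x) (slabFrame j)) =
      (∫ x, Φ (1, x) * Matrix.det (Matrix.of fun j i => fderiv ℝ (G i) (1, x) (0, stdVec j))) -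
        ∫ x, Φ (0, x) * Matrix.det (Matrix.of fun j i => fderiv ℝ (G i) (0, x) (0, stdVec j)) := by
  let h : Equiv.Perm (Fin (n + 1)) → ℝ × EuclideanSpace ℝ (Fin n) → ℝ := fun σ y =>
    Φ y * ∏ i, fderiv ℝ (G i) y (slabFrame (σ i.succ))
  have hh : ∀ σ, ContDiff ℝ 1 (h σ) := fun σ =>
    (hΦ.of_le (by norm_num)).mul (contDiff_prod fun i _ =>
      ((hG i).fderiv_right (m := 1) (by norm_num)).clm_apply contDiff_const)
  have hhz : ∀ σ, ∀ t ∈ Ioo (-(3 / 2) : ℝ) (3 / 2), ∀ x ∉ K, h σ (t, x) = 0 :=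
    fun σ t ht x hx => by simp [h, hz t ht x hx]
  have hdc : ∀ σ v, Continuous fun p => fderiv ℝ (h σ) p v := fun σ v =>
    ((hh σ).continuous_fderiv (by simp)).clm_apply continuous_const
  have hbd : ∀ t ∈ Ioo (-(3 / 2) : ℝ) (3 / 2),
      ∑ σ : Equiv.Perm (Fin (n + 1)), ((Equiv.Perm.sign σ : ℤ) : ℝ) *
        (if σ 0 = 0 then ∫ x, h σ (t, x) else 0) =
      ∫ x, Φ (t, x) * Matrix.det (Matrix.of fun j i => fderiv ℝ (G i) (t, x) (0, stdVec j)) := by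
    intro t ht
    have hi : ∀ σ, Integrable fun x => h σ (t, x) := fun σ =>
      ((hh σ).continuous.comp (by fun_prop : Continuous fun x => (t, x)))
        |>.integrable_of_hasCompactSupport (HasCompactSupport.intro hK (hhz σ t ht))
    have : ∀ x, Φ (t, x) * Matrix.det (Matrix.of fun j i => fderiv ℝ (G i) (t, x) (0, stdVec j)) =
        ∑ σ : Equiv.Perm (Fin (n + 1)), ((Equiv.Perm.sign σ : ℤ) : ℝ) *
          (if σ 0 = 0 then h σ (t, x) else 0) := by
      intro x
      have h1 := Matrix.det_apply' (Matrix.of fun j i : Fin (n + 1) =>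
        (Fin.cons (if j = 0 then Φ (t, x) else 0)
          (fun i : Fin n => fderiv ℝ (G i) (t, x) (slabFrame j)) : Fin (n + 1) → ℝ) i)
      rw [Matrix.det_succ_column_zero, Finset.sum_eq_single 0
        (fun j _ hj => by simp [hj]) (by simp)] at h1
      simp only [Matrix.of_apply, Fin.prod_univ_succ, Fin.cons_zero, Fin.cons_succ, if_true,
        Fin.val_zero, pow_zero, one_mul] at h1
      calc _ = _ := by
            congr 2
        _ = _ := h1
        _ = _ := by
            refine Finset.sum_congr rfl fun σ _ => ?_
            split_ifs <;> simp [h]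
    simp_rw [this]
    rw [integral_finsetSum]
    · refine Finset.sum_congr rfl fun σ _ => ?_
      rw [integral_const_mul]
      split_ifs <;> simp
    · intro σ _
      split_ifs
      · exact (hi σ).const_mul _
      · simp
  rw [← hbd 1 (by norm_num), ← hbd 0 (by norm_num), ← Finset.sum_sub_distrib]
  have hdet : ∀ x, ∫ t in (0 : ℝ)..1, Matrix.det (Matrix.of fun j i =>
        fderiv ℝ ((Fin.cons Φ G : Fin (n + 1) → _ → ℝ) i) (t, x) (slabFrame j)) =
      ∑ σ : Equiv.Perm (Fin (n + 1)), ((Equiv.Perm.sign σ : ℤ) : ℝ) *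
        ∫ t in (0 : ℝ)..1, fderiv ℝ (h σ) (t, x) (slabFrame (σ 0)) := by
    intro x
    simp_rw [← sum_perm_fderiv_eq_det hΦ hG]
    rw [intervalIntegral.integral_finsetSum fun σ _ => ?_]
    · exact Finset.sum_congr rfl fun σ _ => intervalIntegral.integral_const_mul _ _
    · exact (((hdc σ _).comp (by fun_prop : Continuous fun t : ℝ => (t, x))).const_smul
        ((Equiv.Perm.sign σ : ℤ) : ℝ)).intervalIntegrable _ _
  simp_rw [hdet]
  rw [integral_finsetSum _ fun σ _ => (integrable_integral_of_slab (hdc σ _) hK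
    fun t ht x hx => by simp [fderiv_eq_zero_of_slab hK (hhz σ) ht hx]).const_mul _]
  refine Finset.sum_congr rfl fun σ _ => ?_
  rw [integral_const_mul, ← mul_sub]
  congr 1
  rcases Fin.eq_zero_or_eq_succ (σ 0) with h0 | ⟨j, hj⟩
  · rw [h0, if_pos rfl, if_pos rfl]
    exact integral_integral_fderiv_fst_eq (hh σ) hK (hhz σ)
  · rw [hj, if_neg (Fin.succ_ne_zero j), if_neg (Fin.succ_ne_zero j), sub_zero]
    exact integral_integral_fderiv_snd_eq_zero (hh σ) hK (hhz σ) (stdVec j)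

end Slab

/-- The determinant of a linear map on `ℝⁿ` in terms of its coordinates. -/
theorem clm_det_eq {n : ℕ} (T : EuclideanSpace ℝ (Fin n) →L[ℝ] EuclideanSpace ℝ (Fin n)) :
    T.det = Matrix.det (Matrix.of fun j i => T (stdVec j) i) := by
  rw [ContinuousLinearMap.det, ← LinearMap.det_toMatrix (EuclideanSpace.basisFun (Fin n) ℝ).toBasis,
    ← Matrix.det_transpose]
  congr 1

/-- A smooth mollifier supported in the closed unit ball. -/
structure IsMollifier {n : ℕ} (η : EuclideanSpace ℝ (Fin n) → ℝ) : Prop where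
  contDiff : ContDiff ℝ (⊤ : ℕ∞) η
  eq_zero : ∀ z ∉ closedBall (0 : EuclideanSpace ℝ (Fin n)) 1, η z = 0
  integral_eq_one : ∫ z, η z = 1

theorem exists_isMollifier (n : ℕ) : ∃ η : EuclideanSpace ℝ (Fin n) → ℝ, IsMollifier η := by
  let b : ContDiffBump (0 : EuclideanSpace ℝ (Fin n)) := ⟨1 / 2, 1, by norm_num, by norm_num⟩
  refine ⟨b.normed volume, b.contDiff_normed, fun z hz => ?_, b.integral_normed⟩
  have : z ∉ tsupport (b.normed volume) := by rwa [b.tsupport_normed_eq]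
  exact image_eq_zero_of_notMem_tsupport this

theorem IsMollifier.hasCompactSupport {n : ℕ} {η : EuclideanSpace ℝ (Fin n) → ℝ}
    (hη : IsMollifier η) : HasCompactSupport η :=
  HasCompactSupport.intro (isCompact_closedBall 0 1) hη.eq_zero

theorem IsMollifier.fderiv_eq_zero {n : ℕ} {η : EuclideanSpace ℝ (Fin n) → ℝ}
    (hη : IsMollifier η) {z : EuclideanSpace ℝ (Fin n)} (hz : z ∉ closedBall 0 1) :
    fderiv ℝ η z = 0 := by
  have : η =ᶠ[𝓝 z] fun _ => 0 := by
    filter_upwards [isClosed_closedBall.isOpen_compl.mem_nhds hz] with y hy using hη.eq_zero y hy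
  rw [this.fderiv_eq]
  simp

/-- The mollification of `u` at scale `p.1` at the point `p.2`. -/
def mollify {n : ℕ} (η u : EuclideanSpace ℝ (Fin n) → ℝ) (p : ℝ × EuclideanSpace ℝ (Fin n)) : ℝ :=
  ∫ z, u (p.2 + p.1 • z) * η z

section Mollify

variable {n : ℕ} {η u : EuclideanSpace ℝ (Fin n) → ℝ}

theorem mollify_zero (hη : IsMollifier η) (x : EuclideanSpace ℝ (Fin n)) :
    mollify η u (0, x) = u x := by
  simp [mollify, integral_const_mul, hη.integral_eq_one]

theorem contDiff_mollify (hη : IsMollifier η) (hu : ContDiff ℝ (⊤ : ℕ∞) u) :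
    ContDiff ℝ (⊤ : ℕ∞) (mollify η u) := by
  have h := contDiffOn_convolution_right_with_param_comp (n := (⊤ : ℕ∞)) (μ := volume)
    (ContinuousLinearMap.mul ℝ ℝ) (s := univ) (f := fun _ : EuclideanSpace ℝ (Fin n) => (1 : ℝ))
    (v := fun _ : ℝ × EuclideanSpace ℝ (Fin n) => 0)
    (g := fun p z => u (p.2 - p.1 • z) * η (-z)) (k := closedBall 0 1) contDiffOn_const isOpen_univ
    (isCompact_closedBall 0 1) (fun p z _ hz => by
      rw [hη.eq_zero (-z) (by simpa using hz), mul_zero]) (by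
        exact continuous_const.locallyIntegrable) (by
      refine ContDiff.contDiffOn ?_
      have h1 : ContDiff ℝ (⊤ : ℕ∞) fun q : (ℝ × EuclideanSpace ℝ (Fin n)) × EuclideanSpace ℝ (Fin n) =>
        u (q.1.2 - q.1.1 • q.2) := hu.comp (by fun_prop)
      exact h1.mul (hη.contDiff.comp (by fun_prop)))
  rw [contDiffOn_univ] at h
  convert h using 1
  ext p
  simp [mollify, convolution, sub_neg_eq_add]

theorem fderiv_mollify (hη : IsMollifier η) (hu : ContDiff ℝ (⊤ : ℕ∞) u)
    (huc : HasCompactSupport u) (r a : ℝ) (x v : EuclideanSpace ℝ (Fin n)) :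
    fderiv ℝ (mollify η u) (r, x) (a, v) = ∫ z, fderiv ℝ u (x + r • z) (v + a • z) * η z := by
  have hd : Continuous (fderiv ℝ u) := hu.continuous_fderiv (by simp)
  obtain ⟨M, hM⟩ := hd.bounded_above_of_compact_support (huc.fderiv (𝕜 := ℝ))
  have hline : HasDerivAt (fun t : ℝ => ((r, x) : ℝ × EuclideanSpace ℝ (Fin n)) + t • (a, v))
      (a, v) 0 := by
    simpa using ((hasDerivAt_id (0 : ℝ)).smul_const ((a, v) : ℝ × EuclideanSpace ℝ (Fin n))).const_add
      (r, x)
  have h1 : HasDerivAt (fun t : ℝ => mollify η u ((r, x) + t • (a, v)))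
      (fderiv ℝ (mollify η u) (r, x) (a, v)) 0 := by
    have := ((contDiff_mollify hη hu).differentiable (by simp) (r, x)).hasFDerivAt
    exact HasFDerivAt.comp_hasDerivAt (f := fun t : ℝ => ((r, x) : ℝ × EuclideanSpace ℝ (Fin n)) +
      t • (a, v)) 0 (by simpa using this) hline
  have h2 : HasDerivAt (fun t : ℝ => ∫ z, u (x + t • v + (r + t * a) • z) * η z)
      (∫ z, fderiv ℝ u (x + (0 : ℝ) • v + (r + 0 * a) • z) (v + a • z) * η z) 0 := by
    refine (hasDerivAt_integral_of_dominated_loc_of_deriv_le (s := univ)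
      (F := fun (t : ℝ) z => u (x + t • v + (r + t * a) • z) * η z)
      (F' := fun t z => fderiv ℝ u (x + t • v + (r + t * a) • z) (v + a • z) * η z)
      (bound := fun z => M * (‖v‖ + |a|) * |η z|) univ_mem
      (Eventually.of_forall fun t => ?_) ?_ ?_ (Eventually.of_forall fun z t _ => ?_) ?_
      (Eventually.of_forall fun z t _ => ?_)).2
    · exact ((hu.continuous.comp (by fun_prop)).mul hη.contDiff.continuous).aestronglyMeasurable
    · exact ((hu.continuous.comp (by fun_prop)).mul
        hη.contDiff.continuous).integrable_of_hasCompactSupport hη.hasCompactSupport.mul_left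
    · exact (((hd.comp (by fun_prop)).clm_apply (by fun_prop)).mul
        hη.contDiff.continuous).aestronglyMeasurable
    · by_cases hz : z ∈ closedBall (0 : EuclideanSpace ℝ (Fin n)) 1
      · rw [norm_mul, Real.norm_eq_abs (η z)]
        refine mul_le_mul_of_nonneg_right ?_ (abs_nonneg _)
        refine (ContinuousLinearMap.le_opNorm _ _).trans ?_
        refine mul_le_mul (hM _) ((norm_add_le _ _).trans ?_) (norm_nonneg _)
          ((norm_nonneg _).trans (hM 0))
        rw [norm_smul, Real.norm_eq_abs]
        have := mem_closedBall_zero_iff.1 hz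
        nlinarith [abs_nonneg a]
      · simp [hη.eq_zero z hz]
    · exact (hη.contDiff.continuous.integrable_of_hasCompactSupport hη.hasCompactSupport).abs.const_mul _
    · have hl : HasDerivAt (fun t : ℝ => x + t • v + (r + t * a) • z) (v + a • z) t := by
        have e1 : HasDerivAt (fun t : ℝ => x + t • v) v t := by
          simpa using ((hasDerivAt_id t).smul_const v).const_add x
        have e2 : HasDerivAt (fun t : ℝ => (r + t * a) • z) (a • z) t := by
          have := (((hasDerivAt_id t).mul_const a).const_add r).smul_const z
          simpa using this
        exact e1.add e2
      exact ((hu.differentiable (by simp) _).hasFDerivAt.comp_hasDerivAt t hl).mul_const (η z)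
  have := h1.unique (h2.congr_of_eventuallyEq (Eventually.of_forall fun t => ?_))
  · simpa using this
  · simp [mollify]

/-- Integration by parts trades the derivative of `u` for a difference quotient. -/
theorem fderiv_mollify_eq (hη : IsMollifier η) (hu : ContDiff ℝ (⊤ : ℕ∞) u)
    (huc : HasCompactSupport u) {r : ℝ} (hr : 0 < r) (a : ℝ) (x v : EuclideanSpace ℝ (Fin n)) :
    fderiv ℝ (mollify η u) (r, x) (a, v) =
      -(r⁻¹ * ∫ z, (u (x + r • z) - u x) * (n * a * η z + fderiv ℝ η z (v + a • z))) := by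
  let X : Fin n → EuclideanSpace ℝ (Fin n) → ℝ := fun i z => (u (x + r • z) - u x) * (v + a • z) i
  have hU : ContDiff ℝ (⊤ : ℕ∞) fun z => u (x + r • z) - u x :=
    (hu.comp (by fun_prop)).sub contDiff_const
  have hc : ∀ i, ContDiff ℝ (⊤ : ℕ∞) fun z : EuclideanSpace ℝ (Fin n) => (v + a • z) i := fun i => by
    simp only [PiLp.add_apply, PiLp.smul_apply]
    fun_prop
  have hX : ∀ i, ContDiff ℝ (⊤ : ℕ∞) (X i) := fun i => hU.mul (hc i)
  have hsum : ∀ (T : EuclideanSpace ℝ (Fin n) →L[ℝ] ℝ) w, ∑ i, T (stdVec i) * w i = T w := by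
    intro T w
    conv_rhs => rw [← (EuclideanSpace.basisFun (Fin n) ℝ).sum_repr w]
    simp [map_sum, mul_comm]
  have hdX : ∀ z, ∑ i, fderiv ℝ (X i) z (stdVec i) =
      r * fderiv ℝ u (x + r • z) (v + a • z) + n * a * (u (x + r • z) - u x) := by
    intro z
    have h1 : HasFDerivAt (fun z => u (x + r • z) - u x) (r • fderiv ℝ u (x + r • z)) z := by
      have hl : HasFDerivAt (fun z : EuclideanSpace ℝ (Fin n) => x + r • z)
          (r • ContinuousLinearMap.id ℝ _) z := ((hasFDerivAt_id z).const_smul r).const_add x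
      have := ((hu.differentiable (by simp) (x + r • z)).hasFDerivAt.comp z hl).sub_const (u x)
      simpa using this
    have h2 : ∀ i : Fin n, HasFDerivAt (fun z : EuclideanSpace ℝ (Fin n) => (v + a • z) i)
        (a • (EuclideanSpace.proj i : EuclideanSpace ℝ (Fin n) →L[ℝ] ℝ)) z := by
      intro i
      have := (((EuclideanSpace.proj i : EuclideanSpace ℝ (Fin n) →L[ℝ] ℝ).hasFDerivAt
        (x := z)).const_smul a).const_add (v i)
      exact this
    have h3 : ∀ i, fderiv ℝ (X i) z (stdVec i) =
        r * (fderiv ℝ u (x + r • z) (stdVec i) * (v + a • z) i) + a * (u (x + r • z) - u x) := by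
      intro i
      refine (DFunLike.congr_fun (h1.mul (h2 i)).fderiv (stdVec i)).trans ?_
      simp
      ring
    simp_rw [h3, Finset.sum_add_distrib, ← Finset.mul_sum, hsum]
    simp
    ring
  have key := integral_mul_divergence_eq isOpen_univ (hη.contDiff.of_le (by simp))
    hη.hasCompactSupport (subset_univ _) fun i => ((hX i).of_le (by simp)).contDiffOn
  have e1 : ∀ z, ∑ i, fderiv ℝ η z (stdVec i) * X i z =
      (u (x + r • z) - u x) * fderiv ℝ η z (v + a • z) := by
    intro z
    rw [← hsum, Finset.mul_sum]
    exact Finset.sum_congr rfl fun i _ => by simp only [X]; ring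
  simp_rw [hdX, e1] at key
  have cη := hη.contDiff.continuous
  have cdη : Continuous fun z => fderiv ℝ η z (v + a • z) :=
    (hη.contDiff.continuous_fderiv (by simp)).clm_apply (by fun_prop)
  have cdu : Continuous fun z => fderiv ℝ u (x + r • z) (v + a • z) :=
    ((hu.continuous_fderiv (by simp)).comp (by fun_prop)).clm_apply (by fun_prop)
  have hcs : HasCompactSupport fun z => fderiv ℝ η z (v + a • z) :=
    HasCompactSupport.intro (isCompact_closedBall 0 1) fun z hz => by simp [hη.fderiv_eq_zero hz]
  have i1 : Integrable fun z => fderiv ℝ u (x + r • z) (v + a • z) * η z :=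
    (cdu.mul cη).integrable_of_hasCompactSupport hη.hasCompactSupport.mul_left
  have i2 : Integrable fun z => (u (x + r • z) - u x) * (n * a * η z) :=
    (hU.continuous.mul (continuous_const.mul cη)).integrable_of_hasCompactSupport
      (hη.hasCompactSupport.mul_left).mul_left
  have i3 : Integrable fun z => (u (x + r • z) - u x) * fderiv ℝ η z (v + a • z) :=
    (hU.continuous.mul cdη).integrable_of_hasCompactSupport hcs.mul_left
  rw [fderiv_mollify hη hu huc]
  have e2 : ∫ z, η z * (r * fderiv ℝ u (x + r • z) (v + a • z) + n * a * (u (x + r • z) - u x)) =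
      r * (∫ z, fderiv ℝ u (x + r • z) (v + a • z) * η z) +
        ∫ z, (u (x + r • z) - u x) * (n * a * η z) := by
    rw [← integral_const_mul, ← integral_add (i1.const_mul r) i2]
    congr 1
    ext z
    ring
  simp_rw [mul_add (_ - _)]
  rw [integral_add i2 i3, ← neg_eq_iff_eq_neg.2 key, e2]
  set A := ∫ z, (u (x + r • z) - u x) * (n * a * η z)
  field_simp
  ring

theorem exists_abs_fderiv_mollify_le (hη : IsMollifier η) :
    ∃ C : ℝ, 0 ≤ C ∧ ∀ u : EuclideanSpace ℝ (Fin n) → ℝ, ContDiff ℝ (⊤ : ℕ∞) u →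
      HasCompactSupport u → ∀ (r : ℝ), 0 < r → ∀ (a : ℝ) (x v : EuclideanSpace ℝ (Fin n)),
      |fderiv ℝ (mollify η u) (r, x) (a, v)| ≤
        C * (|a| + ‖v‖) * (r⁻¹ * ∫ z in closedBall 0 1, |u (x + r • z) - u x|) := by
  obtain ⟨M₀, hM₀⟩ := hη.contDiff.continuous.bounded_above_of_compact_support hη.hasCompactSupport
  obtain ⟨M₁, hM₁⟩ := (hη.contDiff.continuous_fderiv (by simp)).bounded_above_of_compact_support
    (hη.hasCompactSupport.fderiv (𝕜 := ℝ))
  have p0 : 0 ≤ M₀ := (norm_nonneg _).trans (hM₀ 0)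
  have p1 : 0 ≤ M₁ := (norm_nonneg _).trans (hM₁ 0)
  refine ⟨n * M₀ + M₁, by positivity, fun u hu huc r hr a x v => ?_⟩
  have hc : Continuous fun z => |u (x + r • z) - u x| :=
    ((hu.continuous.comp (by fun_prop)).sub continuous_const).abs
  rw [fderiv_mollify_eq hη hu huc hr, abs_neg, abs_mul, abs_of_pos (inv_pos.2 hr), mul_left_comm]
  refine mul_le_mul_of_nonneg_left ?_ (inv_pos.2 hr).le
  rw [← setIntegral_eq_integral_of_forall_compl_eq_zero (s := closedBall 0 1)
    fun z hz => by simp [hη.eq_zero z hz, hη.fderiv_eq_zero hz], ← integral_const_mul]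
  refine (abs_integral_le_integral_abs).trans (setIntegral_mono_on ?_ ?_ measurableSet_closedBall
    fun z hz => ?_)
  · refine ContinuousOn.integrableOn_compact (isCompact_closedBall 0 1)
      (Continuous.continuousOn (Continuous.abs ?_))
    refine ((hu.continuous.comp (by fun_prop)).sub continuous_const).mul ?_
    exact (continuous_const.mul hη.contDiff.continuous).add
      ((hη.contDiff.continuous_fderiv (by simp)).clm_apply (by fun_prop))
  · exact (continuous_const.mul hc).continuousOn.integrableOn_compact (isCompact_closedBall 0 1)
  · rw [abs_mul, mul_comm]
    refine mul_le_mul_of_nonneg_right ?_ (abs_nonneg _)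
    have h1 : |η z| ≤ M₀ := hM₀ z
    have h2 : |fderiv ℝ η z (v + a • z)| ≤ M₁ * (|a| + ‖v‖) := by
      refine ((fderiv ℝ η z).le_opNorm _).trans ?_
      refine mul_le_mul (hM₁ _) ((norm_add_le _ _).trans ?_) (norm_nonneg _) p1
      rw [norm_smul, Real.norm_eq_abs]
      have := mem_closedBall_zero_iff.1 hz
      nlinarith [abs_nonneg a]
    calc |n * a * η z + fderiv ℝ η z (v + a • z)|
        ≤ |n * a * η z| + |fderiv ℝ η z (v + a • z)| := abs_add_le _ _
      _ ≤ n * |a| * M₀ + M₁ * (|a| + ‖v‖) := by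
          refine add_le_add ?_ h2
          rw [abs_mul, abs_mul, Nat.abs_cast]
          exact mul_le_mul_of_nonneg_left h1 (by positivity)
      _ ≤ (n * M₀ + M₁) * (|a| + ‖v‖) := by
          have : 0 ≤ n * M₀ * ‖v‖ := by positivity
          nlinarith

end Mollify

theorem abs_det_le {m : ℕ} (M : Matrix (Fin m) (Fin m) ℝ) (c b : Fin m → ℝ)
    (h : ∀ j i, |M j i| ≤ c j * b i) : |M.det| ≤ m.factorial * ((∏ j, c j) * ∏ i, b i) := by
  rw [Matrix.det_apply']
  refine (Finset.abs_sum_le_sum_abs _ _).trans ?_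
  refine (Finset.sum_le_card_nsmul _ _ ((∏ j, c j) * ∏ i, b i) fun σ _ => ?_).trans_eq ?_
  · rw [abs_mul, Finset.abs_prod]
    have : |((Equiv.Perm.sign σ : ℤ) : ℝ)| = 1 := by
      rcases Int.units_eq_one_or (Equiv.Perm.sign σ) with h | h <;> simp [h]
    rw [this, one_mul, ← Equiv.prod_comp σ c, ← Finset.prod_mul_distrib]
    exact Finset.prod_le_prod (fun i _ => abs_nonneg _) fun i _ => h _ _
  · rw [Finset.card_univ, Fintype.card_perm, Fintype.card_fin, nsmul_eq_mul]

/-- The mean oscillation of `u` around `x` at scale `r`. -/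
def osc {n : ℕ} {F : Type*} [NormedAddCommGroup F] (u : EuclideanSpace ℝ (Fin n) → F) (r : ℝ)
    (x : EuclideanSpace ℝ (Fin n)) : ℝ :=
  ∫ z in closedBall 0 1, ‖u (x + r • z) - u x‖

theorem osc_nonneg {n : ℕ} {F : Type*} [NormedAddCommGroup F] (u : EuclideanSpace ℝ (Fin n) → F)
    (r : ℝ) (x : EuclideanSpace ℝ (Fin n)) : 0 ≤ osc u r x :=
  integral_nonneg fun _ => norm_nonneg _

theorem continuous_osc {n : ℕ} {F : Type*} [NormedAddCommGroup F]
    {u : EuclideanSpace ℝ (Fin n) → F} (hu : Continuous u) :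
    Continuous fun p : ℝ × EuclideanSpace ℝ (Fin n) => osc u p.1 p.2 :=
  continuous_parametric_integral_of_continuous
    (f := fun (p : ℝ × EuclideanSpace ℝ (Fin n)) z => ‖u (p.2 + p.1 • z) - u p.2‖)
    (by fun_prop) (isCompact_closedBall 0 1)

theorem osc_comp_le {n m : ℕ} {g : EuclideanSpace ℝ (Fin n) → EuclideanSpace ℝ (Fin m)}
    (hg : Continuous g) (i : Fin m) (r : ℝ) (x : EuclideanSpace ℝ (Fin n)) :
    osc (fun y => g y i) r x ≤ osc g r x := by
  refine setIntegral_mono_on ?_ ?_ measurableSet_closedBall fun z _ => ?_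
  · refine ContinuousOn.integrableOn_compact (isCompact_closedBall 0 1) (Continuous.continuousOn ?_)
    fun_prop
  · refine ContinuousOn.integrableOn_compact (isCompact_closedBall 0 1) (Continuous.continuousOn ?_)
    fun_prop
  · exact PiLp.norm_apply_le (g (x + r • z) - g x) i

/-- The homotopy from `u` to its mollification at the variable scale `ρ`. -/
def mollifyHomotopy {n : ℕ} (η ρ u : EuclideanSpace ℝ (Fin n) → ℝ)
    (p : ℝ × EuclideanSpace ℝ (Fin n)) : ℝ :=
  mollify η u (p.1 * ρ p.2, p.2)

section Homotopy

variable {n : ℕ} {η ρ u : EuclideanSpace ℝ (Fin n) → ℝ}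

theorem mollifyHomotopy_zero (hη : IsMollifier η) (x : EuclideanSpace ℝ (Fin n)) :
    mollifyHomotopy η ρ u (0, x) = u x := by
  simp [mollifyHomotopy, mollify_zero hη]

theorem contDiff_mollifyHomotopy (hη : IsMollifier η) (hρ : ContDiff ℝ (⊤ : ℕ∞) ρ)
    (hu : ContDiff ℝ (⊤ : ℕ∞) u) : ContDiff ℝ (⊤ : ℕ∞) (mollifyHomotopy η ρ u) :=
  (contDiff_mollify hη hu).comp
    ((contDiff_fst.mul (hρ.comp contDiff_snd)).prodMk contDiff_snd)

theorem fderiv_mollifyHomotopy (hη : IsMollifier η) (hρ : ContDiff ℝ (⊤ : ℕ∞) ρ)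
    (hu : ContDiff ℝ (⊤ : ℕ∞) u) (t a : ℝ) (x v : EuclideanSpace ℝ (Fin n)) :
    fderiv ℝ (mollifyHomotopy η ρ u) (t, x) (a, v) =
      fderiv ℝ (mollify η u) (t * ρ x, x) (a * ρ x + t * fderiv ℝ ρ x v, v) := by
  have h1 : HasFDerivAt (fun p : ℝ × EuclideanSpace ℝ (Fin n) => ρ p.2)
      ((fderiv ℝ ρ x).comp (ContinuousLinearMap.snd ℝ ℝ _)) (t, x) :=
    HasFDerivAt.comp (t, x) (hρ.differentiable (by simp) x).hasFDerivAt hasFDerivAt_snd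
  have h2 := ((hasFDerivAt_fst (𝕜 := ℝ) (p := (t, x))).mul h1).prodMk
    (hasFDerivAt_snd (𝕜 := ℝ) (p := (t, x)))
  have h3 := HasFDerivAt.comp (t, x)
    (((contDiff_mollify hη hu).differentiable (by simp) (t * ρ x, x)).hasFDerivAt) h2
  refine (DFunLike.congr_fun h3.fderiv (a, v)).trans ?_
  simp only [ContinuousLinearMap.comp_apply, ContinuousLinearMap.prod_apply]
  congr 2
  simp
  ring

theorem exists_abs_fderiv_mollifyHomotopy_le (hη : IsMollifier η) (hρ : ContDiff ℝ (⊤ : ℕ∞) ρ)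
    (hL : LipschitzWith (1 / 2) ρ) :
    ∃ C : ℝ, 0 ≤ C ∧ ∀ u : EuclideanSpace ℝ (Fin n) → ℝ, ContDiff ℝ (⊤ : ℕ∞) u →
      HasCompactSupport u → ∀ t ∈ Ioc (0 : ℝ) 1, ∀ x, 0 < ρ x → ∀ a v,
      |fderiv ℝ (mollifyHomotopy η ρ u) (t, x) (a, v)| ≤
        C * (|a| * ρ x + ‖v‖) * ((t * ρ x)⁻¹ * osc u (t * ρ x) x) := by
  obtain ⟨C, hC, h⟩ := exists_abs_fderiv_mollify_le hη
  refine ⟨2 * C, by positivity, fun u hu huc t ht x hx a v => ?_⟩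
  have hr : 0 < t * ρ x := mul_pos ht.1 hx
  rw [fderiv_mollifyHomotopy hη hρ hu]
  refine (h u hu huc _ hr _ x v).trans ?_
  refine mul_le_mul_of_nonneg_right ?_ (mul_nonneg (inv_pos.2 hr).le (osc_nonneg u _ x))
  have h1 : |fderiv ℝ ρ x v| ≤ ‖v‖ := by
    refine ((fderiv ℝ ρ x).le_opNorm v).trans ?_
    have := norm_fderiv_le_of_lipschitz ℝ hL (x₀ := x)
    norm_num at this
    nlinarith [norm_nonneg v]
  have h2 : |a * ρ x + t * fderiv ℝ ρ x v| ≤ |a| * ρ x + ‖v‖ := by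
    refine (abs_add_le _ _).trans ?_
    rw [abs_mul, abs_mul, abs_of_pos hx, abs_of_pos ht.1]
    have := mul_le_mul ht.2 h1 (abs_nonneg _) zero_le_one
    linarith
  have h3 : 0 ≤ |a| * ρ x := by positivity
  nlinarith [norm_nonneg v]

/-- The Jacobian of the homotopy of `(φ, g)` is controlled by mean oscillations. -/
theorem exists_abs_det_mollifyHomotopy_le (hη : IsMollifier η) (hρ : ContDiff ℝ (⊤ : ℕ∞) ρ)
    (hL : LipschitzWith (1 / 2) ρ) :
    ∃ C : ℝ, 0 ≤ C ∧ ∀ (φ : EuclideanSpace ℝ (Fin n) → ℝ)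
      (g : EuclideanSpace ℝ (Fin n) → EuclideanSpace ℝ (Fin n)),
      ContDiff ℝ (⊤ : ℕ∞) φ → HasCompactSupport φ → ContDiff ℝ (⊤ : ℕ∞) g → HasCompactSupport g →
      ∀ x, 0 < ρ x →
      (∀ t ∈ Ioc (0 : ℝ) 1, |Matrix.det (Matrix.of fun j i : Fin (n + 1) =>
        fderiv ℝ ((Fin.cons (mollifyHomotopy η ρ φ) (fun i => mollifyHomotopy η ρ fun y => g y i) :
          Fin (n + 1) → _ → ℝ) i) (t, x) (slabFrame j))| ≤
        C * (ρ x * ((t * ρ x)⁻¹ * osc g (t * ρ x) x) ^ n * ((t * ρ x)⁻¹ * osc φ (t * ρ x) x))) ∧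
      |Matrix.det (Matrix.of fun j i : Fin n =>
        fderiv ℝ (mollifyHomotopy η ρ fun y => g y i) (1, x) (0, stdVec j))| ≤
        C * ((ρ x)⁻¹ * osc g (ρ x) x) ^ n ∧
      ‖fderiv ℝ (fun y => mollifyHomotopy η ρ φ (1, y)) x‖ ≤ C * ((ρ x)⁻¹ * osc φ (ρ x) x) := by
  obtain ⟨C, hC, h⟩ := exists_abs_fderiv_mollifyHomotopy_le hη hρ hL
  set C₁ : ℝ := (n + 1).factorial * C ^ (n + 1)
  set C₂ : ℝ := n.factorial * C ^ n
  have p1 : 0 ≤ C₁ := by positivity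
  have p2 : 0 ≤ C₂ := by positivity
  refine ⟨C₁ + C₂ + C, by positivity, fun φ g hφ hφc hg hgc x hx => ⟨fun t ht => ?_, ?_, ?_⟩⟩
  all_goals
    have hgi : ∀ i : Fin n, ContDiff ℝ (⊤ : ℕ∞) fun y => g y i := fun i =>
      (contDiff_euclidean.1 hg) i
    have hgci : ∀ i : Fin n, HasCompactSupport fun y => g y i := fun i =>
      hgc.comp_left (g := fun w : EuclideanSpace ℝ (Fin n) => w i) rfl
  · have hr : 0 < t * ρ x := mul_pos ht.1 hx
    have hB : ∀ {F : Type} [NormedAddCommGroup F] (u : EuclideanSpace ℝ (Fin n) → F),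
        0 ≤ (t * ρ x)⁻¹ * osc u (t * ρ x) x := fun u =>
      mul_nonneg (inv_pos.2 hr).le (osc_nonneg u _ _)
    set Bφ := (t * ρ x)⁻¹ * osc φ (t * ρ x) x with hBφ
    set Bg := (t * ρ x)⁻¹ * osc g (t * ρ x) x with hBg
    have hc : ∀ j : Fin (n + 1), |(slabFrame j : ℝ × EuclideanSpace ℝ (Fin n)).1| * ρ x +
        ‖(slabFrame j : ℝ × EuclideanSpace ℝ (Fin n)).2‖ =
        (Fin.cons (ρ x) (fun _ => 1) : Fin (n + 1) → ℝ) j := fun j => by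
      refine Fin.cases ?_ (fun j => ?_) j <;> simp [slabFrame]
    have hc0 : ∀ j, 0 ≤ (Fin.cons (ρ x) (fun _ => 1) : Fin (n + 1) → ℝ) j := fun j => by
      refine Fin.cases ?_ (fun j => ?_) j <;> simp [hx.le]
    refine (abs_det_le _ (Fin.cons (ρ x) fun _ => 1)
      (fun i => C * (Fin.cons Bφ (fun _ => Bg) : Fin (n + 1) → ℝ) i) fun j i => ?_).trans ?_
    · rw [Matrix.of_apply]
      refine Fin.cases ?_ (fun i => ?_) i
      · have := h φ hφ hφc t ht x hx (slabFrame j).1 (slabFrame j).2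
        rw [hc] at this
        simp only [Fin.cons_zero]
        calc _ ≤ _ := this
          _ = _ := by rw [hBφ]; ring
      · have := h _ (hgi i) (hgci i) t ht x hx (slabFrame j).1 (slabFrame j).2
        rw [hc] at this
        simp only [Fin.cons_succ]
        have h2 : (t * ρ x)⁻¹ * osc (fun y => g y i) (t * ρ x) x ≤ Bg :=
          mul_le_mul_of_nonneg_left (osc_comp_le hg.continuous i _ x) (inv_pos.2 hr).le
        calc _ ≤ _ := this
          _ ≤ C * (Fin.cons (ρ x) (fun _ => 1) : Fin (n + 1) → ℝ) j * Bg :=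
            mul_le_mul_of_nonneg_left h2 (mul_nonneg hC (hc0 j))
          _ = _ := by ring
    · have h0 : 0 ≤ ρ x * Bg ^ n * Bφ := mul_nonneg (mul_nonneg hx.le (pow_nonneg (hB g) n)) (hB φ)
      have : ((n + 1).factorial : ℝ) * ((∏ j, (Fin.cons (ρ x) (fun _ => 1) : Fin (n + 1) → ℝ) j) *
          ∏ i, C * (Fin.cons Bφ (fun _ => Bg) : Fin (n + 1) → ℝ) i) = C₁ * (ρ x * Bg ^ n * Bφ) := by
        rw [Fin.prod_univ_succ, Finset.prod_mul_distrib, Fin.prod_univ_succ (n := n)]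
        simp [C₁]
        ring
      rw [this]
      exact mul_le_mul_of_nonneg_right (by linarith) h0
  · set Bg := (ρ x)⁻¹ * osc g (ρ x) x with hBg
    have hB : 0 ≤ Bg := mul_nonneg (inv_pos.2 hx).le (osc_nonneg g _ _)
    refine (abs_det_le _ (fun _ => 1) (fun _ => C * Bg) fun j i => ?_).trans ?_
    · have := h _ (hgi i) (hgci i) 1 (by simp) x hx 0 (stdVec j)
      simp only [abs_zero, zero_mul, zero_add, norm_stdVec, mul_one, one_mul] at this ⊢
      exact this.trans (mul_le_mul_of_nonneg_left
        (mul_le_mul_of_nonneg_left (osc_comp_le hg.continuous i _ x) (inv_pos.2 hx).le) hC)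
    · have h0 := pow_nonneg hB n
      simp only [Finset.prod_const, one_pow, one_mul, Finset.card_univ, Fintype.card_fin, mul_pow]
      calc (n.factorial : ℝ) * (C ^ n * Bg ^ n) = C₂ * Bg ^ n := by simp only [C₂]; ring
        _ ≤ _ := mul_le_mul_of_nonneg_right (by linarith) h0
  · have hB : 0 ≤ (ρ x)⁻¹ * osc φ (ρ x) x := mul_nonneg (inv_pos.2 hx).le (osc_nonneg φ _ _)
    refine le_trans ?_ (mul_le_mul_of_nonneg_right (by linarith : C ≤ C₁ + C₂ + C) hB)
    refine ContinuousLinearMap.opNorm_le_bound _ (mul_nonneg hC hB) fun v => ?_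
    have hd : HasFDerivAt (fun y => mollifyHomotopy η ρ φ (1, y))
        ((fderiv ℝ (mollifyHomotopy η ρ φ) (1, x)).comp (ContinuousLinearMap.inr ℝ ℝ _)) x :=
      ((contDiff_mollifyHomotopy hη hρ hφ).differentiable (by simp) (1, x)).hasFDerivAt.comp x
        (hasFDerivAt_prodMk_right 1 x)
    rw [hd.fderiv]
    have := h φ hφ hφc 1 (by simp) x hx 0 v
    simp only [abs_zero, zero_mul, zero_add, one_mul] at this
    simp only [ContinuousLinearMap.comp_apply, ContinuousLinearMap.inr_apply, Real.norm_eq_abs]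
    linarith

end Homotopy

theorem setLIntegral_closedBall_comp_smul {n : ℕ} {w : EuclideanSpace ℝ (Fin n) → ℝ≥0∞}
    (hw : Measurable w) (x : EuclideanSpace ℝ (Fin n)) {r : ℝ} (hr : 0 < r) :
    ∫⁻ z in closedBall 0 1, w (x + r • z) =
      ENNReal.ofReal (r ^ (-(n : ℝ))) * ∫⁻ y in closedBall x r, w y := by
  let W : EuclideanSpace ℝ (Fin n) → ℝ≥0∞ := fun y => (closedBall x r).indicator w (x + y)
  have hW : Measurable W := (hw.indicator measurableSet_closedBall).comp (measurable_const_add x)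
  have h1 : ∫⁻ z in closedBall 0 1, w (x + r • z) = ∫⁻ z, W (r • z) := by
    rw [← lintegral_indicator measurableSet_closedBall]
    refine lintegral_congr fun z => ?_
    have : x + r • z ∈ closedBall x r ↔ z ∈ closedBall (0 : EuclideanSpace ℝ (Fin n)) 1 := by
      rw [mem_closedBall_iff_norm, mem_closedBall_zero_iff, add_sub_cancel_left, norm_smul,
        Real.norm_of_nonneg hr.le, mul_le_iff_le_one_right hr]
    by_cases hz : z ∈ closedBall (0 : EuclideanSpace ℝ (Fin n)) 1
    · simp only [W, indicator_of_mem hz, indicator_of_mem (this.2 hz)]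
    · simp only [W, indicator_of_notMem hz, indicator_of_notMem (fun h => hz (this.1 h))]
  rw [h1, ← lintegral_map hW (measurable_const_smul r), Measure.map_addHaar_smul _ hr.ne',
    lintegral_smul_measure, lintegral_add_left_eq_self (fun y => (closedBall x r).indicator w y),
    lintegral_indicator measurableSet_closedBall, finrank_euclideanSpace_fin, smul_eq_mul,
    abs_of_pos (by positivity), Real.rpow_neg hr.le, Real.rpow_natCast]

section Oscillation

variable {n : ℕ} {F : Type*} [NormedAddCommGroup F] {u : EuclideanSpace ℝ (Fin n) → F}

/-- The constant from Jensen's inequality on the unit ball. -/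
def ballConst (n : ℕ) (q : ℝ) : ℝ≥0∞ :=
  volume (closedBall (0 : EuclideanSpace ℝ (Fin n)) 1) ^ (q - 1)

theorem ballConst_ne_top {q : ℝ} (hq : 1 ≤ q) : ballConst n q ≠ ∞ :=
  ENNReal.rpow_ne_top_of_nonneg (by linarith) measure_closedBall_lt_top.ne

theorem ofReal_osc_rpow_le (hu : Continuous u) {q : ℝ} (hq : 1 ≤ q) (r : ℝ)
    (x : EuclideanSpace ℝ (Fin n)) :
    ENNReal.ofReal (osc u r x) ^ q ≤
      ballConst n q * ∫⁻ z in closedBall 0 1, ‖u x - u (x + r • z)‖ₑ ^ q := by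
  have hq0 : 0 < q := by linarith
  have hm : Measurable fun z : EuclideanSpace ℝ (Fin n) => ‖u x - u (x + r • z)‖ₑ ^ q :=
    (by fun_prop : Continuous fun z : EuclideanSpace ℝ (Fin n) =>
      ‖u x - u (x + r • z)‖ₑ).measurable.pow_const q
  have h1 : ENNReal.ofReal (osc u r x) ≤ ∫⁻ z in closedBall 0 1, ‖u x - u (x + r • z)‖ₑ := by
    rw [← Real.enorm_of_nonneg (osc_nonneg u r x)]
    refine (enorm_integral_le_lintegral_enorm _).trans_eq (lintegral_congr fun z => ?_)
    rw [enorm_norm, ← enorm_neg, neg_sub]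
  have h2 := ENNReal.lintegral_mul_norm_pow_le
    (μ := volume.restrict (closedBall (0 : EuclideanSpace ℝ (Fin n)) 1))
    hm.aemeasurable (aemeasurable_const (b := (1 : ℝ≥0∞))) (p := 1 / q) (q := 1 - 1 / q)
    (by positivity) (by rw [sub_nonneg, div_le_one hq0]; exact hq) (by ring)
  simp only [ENNReal.one_rpow, mul_one, ← ENNReal.rpow_mul, mul_one_div_cancel hq0.ne',
    ENNReal.rpow_one, lintegral_const, one_mul, Measure.restrict_apply_univ] at h2
  refine (ENNReal.rpow_le_rpow (h1.trans h2) hq0.le).trans_eq ?_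
  rw [ENNReal.mul_rpow_of_nonneg _ _ hq0.le, ← ENNReal.rpow_mul, ← ENNReal.rpow_mul,
    one_div_mul_cancel hq0.ne', ENNReal.rpow_one, mul_comm, ballConst, sub_mul,
    one_div_mul_cancel hq0.ne', one_mul]

theorem ofReal_mul_osc_rpow_le (hu : Continuous u) {q : ℝ} (hq : 1 ≤ q) {r c : ℝ} (hr : 0 < r)
    (hc : 0 ≤ c) (x : EuclideanSpace ℝ (Fin n)) :
    ENNReal.ofReal (c * (r⁻¹ * osc u r x) ^ q) ≤
      ballConst n q * (ENNReal.ofReal (c * r ^ (-q - n)) *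
        ∫⁻ y in closedBall x r, ‖u x - u y‖ₑ ^ q) := by
  have hq0 : 0 < q := by linarith
  have hm : Measurable fun y : EuclideanSpace ℝ (Fin n) => ‖u x - u y‖ₑ ^ q :=
    (by fun_prop : Continuous fun y : EuclideanSpace ℝ (Fin n) =>
      ‖u x - u y‖ₑ).measurable.pow_const q
  have h := ofReal_osc_rpow_le hu hq r x
  rw [setLIntegral_closedBall_comp_smul hm x hr] at h
  rw [Real.mul_rpow (inv_pos.2 hr).le (osc_nonneg u r x), ← mul_assoc,
    ENNReal.ofReal_mul (by positivity), ← ENNReal.ofReal_rpow_of_nonneg (osc_nonneg u r x) hq0.le]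
  refine (mul_le_mul_right h _).trans_eq ?_
  have e : ENNReal.ofReal (c * r ^ (-q - n)) =
      ENNReal.ofReal (c * r⁻¹ ^ q) * ENNReal.ofReal (r ^ (-(n : ℝ))) := by
    rw [← ENNReal.ofReal_mul (by positivity), sub_eq_add_neg, Real.rpow_add hr,
      Real.inv_rpow hr.le, Real.rpow_neg hr.le, mul_assoc]
  rw [e]
  ring

/-- The Gagliardo integrand with the critical kernel `|x - y|^(-2n)`. -/
def gagliardoKernel {n : ℕ} {F : Type*} [NormedAddCommGroup F] (q : ℝ)
    (u : EuclideanSpace ℝ (Fin n) → F) (x y : EuclideanSpace ℝ (Fin n)) : ℝ≥0∞ :=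
  ‖u x - u y‖ₑ ^ q / ‖x - y‖ₑ ^ (2 * n : ℝ)

theorem measurable_gagliardoKernel (hu : Continuous u) (q : ℝ) :
    Measurable (Function.uncurry (gagliardoKernel q u)) :=
  ((by fun_prop : Continuous fun p : EuclideanSpace ℝ (Fin n) × EuclideanSpace ℝ (Fin n) =>
      ‖u p.1 - u p.2‖ₑ).measurable.pow_const q).div
    ((by fun_prop : Continuous fun p : EuclideanSpace ℝ (Fin n) × EuclideanSpace ℝ (Fin n) =>
      ‖p.1 - p.2‖ₑ).measurable.pow_const _)

/-- Mean oscillation at the single scale `R`. -/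
theorem osc_single_scale_le (hu : Continuous u) {q : ℝ} (hq : 1 ≤ q) {R : ℝ} (hR : 0 < R)
    (x : EuclideanSpace ℝ (Fin n)) :
    ENNReal.ofReal (R ^ (q - n) * (R⁻¹ * osc u R x) ^ q) ≤
      ballConst n q * ∫⁻ y in closedBall x R, gagliardoKernel q u x y := by
  refine (ofReal_mul_osc_rpow_le hu hq hR (by positivity) x).trans (mul_le_mul_right ?_ _)
  have hm : Measurable fun y : EuclideanSpace ℝ (Fin n) => ‖u x - u y‖ₑ ^ q :=
    (by fun_prop : Continuous fun y : EuclideanSpace ℝ (Fin n) =>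
      ‖u x - u y‖ₑ).measurable.pow_const q
  rw [← lintegral_const_mul _ hm]
  refine setLIntegral_mono' measurableSet_closedBall fun y hy => ?_
  rw [gagliardoKernel, ENNReal.div_eq_inv_mul, ← Real.rpow_add hR,
    show q - n + (-q - n) = -(2 * n : ℝ) by ring, Real.rpow_neg hR.le,
    ENNReal.ofReal_inv_of_pos (by positivity)]
  refine mul_le_mul_left (ENNReal.inv_le_inv.2 ?_) _
  rw [← ENNReal.ofReal_rpow_of_nonneg hR.le (by positivity)]
  refine ENNReal.rpow_le_rpow ?_ (by positivity)
  rw [← ofReal_norm]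
  exact ENNReal.ofReal_le_ofReal (by rw [← dist_eq_norm, dist_comm]; exact hy)

theorem lintegral_Ici_rpow_le {R d m : ℝ} (hR : 0 < R) (hd : 0 < d) (hm : 1 ≤ m) :
    ∫⁻ t in Ici (d / R), ENNReal.ofReal (R * (t * R) ^ (-m - 1)) ≤ ENNReal.ofReal (d ^ (-m)) := by
  have hdR : 0 < d / R := by positivity
  have hm1 : -m - 1 < -1 := by linarith
  rw [← restrict_Ioi_eq_restrict_Ici]
  have h1 : ∀ t ∈ Ioi (d / R), R * (t * R) ^ (-m - 1) = R ^ (-m) * t ^ (-m - 1) := by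
    intro t ht
    have ht0 : 0 < t := hdR.trans ht
    rw [Real.mul_rpow ht0.le hR.le, show -m = 1 + (-m - 1) by ring, Real.rpow_add hR, Real.rpow_one]
    ring_nf
  rw [setLIntegral_congr_fun measurableSet_Ioi fun t ht => by rw [h1 t ht],
    ← ofReal_integral_eq_lintegral_ofReal ((integrableOn_Ioi_rpow_of_lt hm1 hdR).const_mul _),
    integral_const_mul, integral_Ioi_rpow_of_lt hm1 hdR]
  · refine ENNReal.ofReal_le_ofReal ?_
    have h2 : R ^ (-m) * (d / R) ^ (-m) = d ^ (-m) := by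
      rw [← Real.mul_rpow hR.le hdR.le, mul_div_cancel₀ _ hR.ne']
    have h3 : 0 ≤ d ^ (-m) := by positivity
    rw [sub_add_cancel, neg_div_neg_eq, ← mul_div_assoc, h2]
    exact div_le_self h3 hm
  · filter_upwards [self_mem_ae_restrict measurableSet_Ioi] with t ht
    have ht0 : 0 < t := hdR.trans ht
    simp only [Pi.zero_apply]
    positivity

/-- Mean oscillations integrated over all scales `t R`, `0 < t ≤ 1`. -/
theorem lintegral_osc_scales_le (hn : 1 ≤ n) (hu : Continuous u) {q : ℝ} (hq : 1 ≤ q) {R : ℝ}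
    (hR : 0 < R) (x : EuclideanSpace ℝ (Fin n)) :
    ∫⁻ t in Ioc (0 : ℝ) 1, ENNReal.ofReal (R * (t * R) ^ (q - n - 1) *
        ((t * R)⁻¹ * osc u (t * R) x) ^ q) ≤
      ballConst n q * ∫⁻ y in closedBall x R, gagliardoKernel q u x y := by
  have hm : Measurable fun y : EuclideanSpace ℝ (Fin n) => ‖u x - u y‖ₑ ^ q :=
    (by fun_prop : Continuous fun y : EuclideanSpace ℝ (Fin n) =>
      ‖u x - u y‖ₑ).measurable.pow_const q
  let k : ℝ → ℝ≥0∞ := fun t => ENNReal.ofReal (R * (t * R) ^ (-(2 * n : ℝ) - 1))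
  have hk : Measurable k := by fun_prop
  let Ψ : ℝ → EuclideanSpace ℝ (Fin n) → ℝ≥0∞ := fun t y =>
    {p : ℝ × EuclideanSpace ℝ (Fin n) | dist p.2 x ≤ p.1 * R}.indicator
      (fun p => k p.1 * ‖u x - u p.2‖ₑ ^ q) (t, y)
  have hS : MeasurableSet {p : ℝ × EuclideanSpace ℝ (Fin n) | dist p.2 x ≤ p.1 * R} :=
    (isClosed_le (by fun_prop) (by fun_prop)).measurableSet
  have hΨ : Measurable (Function.uncurry Ψ) :=
    ((hk.comp measurable_fst).mul (hm.comp measurable_snd)).indicator hS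
  have h1 : ∀ t ∈ Ioc (0 : ℝ) 1, ENNReal.ofReal (R * (t * R) ^ (q - n - 1) *
        ((t * R)⁻¹ * osc u (t * R) x) ^ q) ≤
      ballConst n q * ∫⁻ y in closedBall x R, Ψ t y := by
    intro t ht
    have hr : 0 < t * R := mul_pos ht.1 hR
    refine (ofReal_mul_osc_rpow_le hu hq hr (by positivity) x).trans (mul_le_mul_right ?_ _)
    rw [mul_assoc, ← Real.rpow_add hr, show q - n - 1 + (-q - n) = -(2 * n : ℝ) - 1 by ring,
      ← lintegral_const_mul _ hm, ← lintegral_indicator measurableSet_closedBall,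
      ← lintegral_indicator measurableSet_closedBall]
    refine lintegral_mono fun y => ?_
    by_cases hy : y ∈ closedBall x (t * R)
    · have hy' : y ∈ closedBall x R :=
        closedBall_subset_closedBall (by nlinarith [ht.2]) hy
      rw [indicator_of_mem hy, indicator_of_mem hy']
      simp only [Ψ]
      rw [indicator_of_mem (by exact hy)]
    · rw [indicator_of_notMem hy]
      exact zero_le
  refine (setLIntegral_mono' measurableSet_Ioc h1).trans ?_
  rw [lintegral_const_mul _ (hΨ.lintegral_prod_right (ν := volume.restrict (closedBall x R)))]
  refine mul_le_mul_right ?_ _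
  rw [lintegral_lintegral_swap hΨ.aemeasurable]
  refine lintegral_mono fun y => ?_
  rcases eq_or_ne y x with rfl | hyx
  · have : ∀ t, Ψ t y = 0 := fun t => by
      simp only [Ψ, indicator_apply, sub_self, enorm_zero]
      rw [ENNReal.zero_rpow_of_pos (by linarith)]
      simp
    simp [this]
  · have hd : 0 < dist y x := dist_pos.2 hyx
    have hn' : (1 : ℝ) ≤ 2 * n := by
      have : (1 : ℝ) ≤ n := by exact_mod_cast hn
      linarith
    have h2 : ∀ t, Ψ t y = ((Ici (dist y x / R)).indicator k t) * ‖u x - u y‖ₑ ^ q := by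
      intro t
      simp only [Ψ, indicator_apply, Set.mem_ofPred_eq, mem_Ici, div_le_iff₀ hR]
      split_ifs <;> simp
    simp_rw [h2]
    rw [lintegral_mul_const _ (hk.indicator measurableSet_Ici), gagliardoKernel,
      ENNReal.div_eq_inv_mul]
    refine mul_le_mul_left ?_ _
    refine (setLIntegral_le_lintegral _ _).trans ?_
    rw [lintegral_indicator measurableSet_Ici]
    refine (lintegral_Ici_rpow_le hR hd hn').trans_eq ?_
    rw [Real.rpow_neg dist_nonneg, ENNReal.ofReal_inv_of_pos (by positivity),
      ← ENNReal.ofReal_rpow_of_nonneg dist_nonneg (by positivity), dist_comm, dist_eq_norm,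
      ofReal_norm]

end Oscillation

theorem mul_pow_mul_eq_interpolation {n : ℕ} {s R r b e : ℝ} (hs : 0 < s) (hs1 : s < 1) (hR : 0 < R)
    (hr : 0 < r) (hb : 0 ≤ b) (he : 0 ≤ e) :
    R * b ^ n * e = (R * r ^ ((n : ℝ) / s - n - 1) * b ^ ((n : ℝ) / s)) ^ s *
      (R * r ^ (1 / (1 - s) - n - 1) * e ^ (1 / (1 - s))) ^ (1 - s) := by
  have h1 : 0 < 1 - s := by linarith
  rw [Real.mul_rpow (by positivity) (by positivity), Real.mul_rpow (by positivity) (by positivity),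
    Real.mul_rpow (by positivity) (by positivity), Real.mul_rpow (by positivity) (by positivity),
    ← Real.rpow_mul hr.le, ← Real.rpow_mul hr.le, ← Real.rpow_mul hb, ← Real.rpow_mul he,
    div_mul_cancel₀ _ hs.ne', one_div_mul_cancel h1.ne', Real.rpow_one, Real.rpow_natCast]
  have e1 : R ^ s * R ^ (1 - s) = R := by rw [← Real.rpow_add hR]; simp
  have e2 : r ^ (((n : ℝ) / s - n - 1) * s) * r ^ ((1 / (1 - s) - n - 1) * (1 - s)) = 1 := by
    rw [← Real.rpow_add hr]
    have : ((n : ℝ) / s - n - 1) * s + (1 / (1 - s) - n - 1) * (1 - s) = 0 := by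
      field_simp
      ring
    rw [this, Real.rpow_zero]
  calc R * b ^ n * e = (R ^ s * R ^ (1 - s)) * (r ^ (((n : ℝ) / s - n - 1) * s) *
        r ^ ((1 / (1 - s) - n - 1) * (1 - s))) * b ^ n * e := by rw [e1, e2, mul_one]
    _ = _ := by ring

theorem pow_mul_eq_interpolation {n : ℕ} {s R b e : ℝ} (hs : 0 < s) (hs1 : s < 1) (hR : 0 < R)
    (hb : 0 ≤ b) (he : 0 ≤ e) :
    b ^ n * e = (R ^ ((n : ℝ) / s - n) * b ^ ((n : ℝ) / s)) ^ s *
      (e ^ (1 / (1 - s)) * R ^ (-(n : ℝ))) ^ (1 - s) := by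
  have h1 : 0 < 1 - s := by linarith
  rw [Real.mul_rpow (by positivity) (by positivity), Real.mul_rpow (by positivity) (by positivity),
    ← Real.rpow_mul hR.le, ← Real.rpow_mul hR.le, ← Real.rpow_mul hb, ← Real.rpow_mul he,
    div_mul_cancel₀ _ hs.ne', one_div_mul_cancel h1.ne', Real.rpow_one, Real.rpow_natCast]
  have e2 : R ^ (((n : ℝ) / s - n) * s) * R ^ (-(n : ℝ) * (1 - s)) = 1 := by
    rw [← Real.rpow_add hR]
    have : ((n : ℝ) / s - n) * s + -(n : ℝ) * (1 - s) = 0 := by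
      field_simp
      ring
    rw [this, Real.rpow_zero]
  calc b ^ n * e = (R ^ (((n : ℝ) / s - n) * s) * R ^ (-(n : ℝ) * (1 - s))) * (b ^ n * e) := by
        rw [e2, one_mul]
    _ = _ := by ring

section Energy

variable {n : ℕ} {F : Type*} [NormedAddCommGroup F] {u : EuclideanSpace ℝ (Fin n) → F}
  {ρ : EuclideanSpace ℝ (Fin n) → ℝ}

/-- The Gagliardo energy density of `u` at `x`, restricted to the ball of radius `ρ x`. -/
def localEnergy {n : ℕ} {F : Type*} [NormedAddCommGroup F] (ρ : EuclideanSpace ℝ (Fin n) → ℝ)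
    (q : ℝ) (u : EuclideanSpace ℝ (Fin n) → F) (x : EuclideanSpace ℝ (Fin n)) : ℝ≥0∞ :=
  ∫⁻ y in closedBall x (ρ x), gagliardoKernel q u x y

theorem measurable_localEnergy (hρ : Continuous ρ) (hu : Continuous u) (q : ℝ) :
    Measurable (localEnergy ρ q u) := by
  have hS : MeasurableSet {p : EuclideanSpace ℝ (Fin n) × EuclideanSpace ℝ (Fin n) |
      dist p.2 p.1 ≤ ρ p.1} := (isClosed_le (by fun_prop) (by fun_prop)).measurableSet
  have h := ((measurable_gagliardoKernel hu q).indicator hS).lintegral_prod_right' (ν := volume)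
  convert h using 1
  ext x
  rw [localEnergy, ← lintegral_indicator measurableSet_closedBall]
  rfl

theorem measurable_mul_osc (hu : Continuous u) (R : ℝ) (x : EuclideanSpace ℝ (Fin n)) :
    Measurable fun t : ℝ => (t * R)⁻¹ * osc u (t * R) x := by
  have : Continuous fun t : ℝ => osc u (t * R) x :=
    (continuous_osc hu).comp (by fun_prop : Continuous fun t : ℝ => (t * R, x))
  have := this.measurable
  fun_prop

/-- Interpolation between the two energies along the scales `t ρ`. -/
theorem lintegral_scales_interpolation_le (hn : 1 ≤ n) {s : ℝ} (hs : 0 < s) (hs1 : s < 1)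
    {g : EuclideanSpace ℝ (Fin n) → EuclideanSpace ℝ (Fin n)} (hg : Continuous g)
    {φ : EuclideanSpace ℝ (Fin n) → ℝ} (hφ : Continuous φ) {x : EuclideanSpace ℝ (Fin n)}
    (hx : 0 < ρ x) :
    ∫⁻ t in Ioc (0 : ℝ) 1, ENNReal.ofReal (ρ x * ((t * ρ x)⁻¹ * osc g (t * ρ x) x) ^ n *
        ((t * ρ x)⁻¹ * osc φ (t * ρ x) x)) ≤
      (ballConst n (n / s) * localEnergy ρ (n / s) g x) ^ s *
        (ballConst n (1 / (1 - s)) * localEnergy ρ (1 / (1 - s)) φ x) ^ (1 - s) := by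
  have h1 : 0 < 1 - s := by linarith
  have hq : (1 : ℝ) ≤ n / s := by
    rw [le_div_iff₀ hs]
    have : (1 : ℝ) ≤ n := by exact_mod_cast hn
    linarith
  have hp : (1 : ℝ) ≤ 1 / (1 - s) := by rw [le_div_iff₀ h1]; linarith
  have mg := measurable_mul_osc hg (ρ x) x
  have mφ := measurable_mul_osc hφ (ρ x) x
  refine le_trans (le_of_eq ?_) ((ENNReal.lintegral_mul_norm_pow_le
    (μ := volume.restrict (Ioc (0 : ℝ) 1))
    (f := fun t => ENNReal.ofReal (ρ x * (t * ρ x) ^ ((n : ℝ) / s - n - 1) *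
        ((t * ρ x)⁻¹ * osc g (t * ρ x) x) ^ ((n : ℝ) / s)))
    (g := fun t => ENNReal.ofReal (ρ x * (t * ρ x) ^ (1 / (1 - s) - n - 1) *
        ((t * ρ x)⁻¹ * osc φ (t * ρ x) x) ^ (1 / (1 - s))))
    (by fun_prop) (by fun_prop) hs.le h1.le (by ring)).trans
    (mul_le_mul' (ENNReal.rpow_le_rpow (lintegral_osc_scales_le hn hg hq hx x) hs.le)
      (ENNReal.rpow_le_rpow (lintegral_osc_scales_le hn hφ hp hx x) h1.le)))
  refine setLIntegral_congr_fun measurableSet_Ioc fun t ht => ?_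
  have hr : 0 < t * ρ x := mul_pos ht.1 hx
  have bg : 0 ≤ (t * ρ x)⁻¹ * osc g (t * ρ x) x := mul_nonneg (inv_pos.2 hr).le (osc_nonneg _ _ _)
  have bφ : 0 ≤ (t * ρ x)⁻¹ * osc φ (t * ρ x) x := mul_nonneg (inv_pos.2 hr).le (osc_nonneg _ _ _)
  rw [ENNReal.ofReal_rpow_of_nonneg (by positivity) hs.le,
    ENNReal.ofReal_rpow_of_nonneg (by positivity) h1.le, ← ENNReal.ofReal_mul (by positivity),
    ← mul_pow_mul_eq_interpolation hs hs1 hx hr bg bφ]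

end Energy

theorem ennreal_const_mul_rpow (A B E D : ℝ≥0∞) {s : ℝ} (hs : 0 ≤ s) (hs1 : s ≤ 1) :
    (A * E) ^ s * (B * D) ^ (1 - s) = (A ^ s * B ^ (1 - s)) * (E ^ s * D ^ (1 - s)) := by
  rw [ENNReal.mul_rpow_of_nonneg _ _ hs, ENNReal.mul_rpow_of_nonneg _ _ (sub_nonneg.2 hs1)]
  ring

section Estimates

variable {n : ℕ} {η ρ : EuclideanSpace ℝ (Fin n) → ℝ}

/-- The bulk term of the homotopy formula. -/
theorem exists_bulk_estimate (hn : 1 ≤ n) {s : ℝ} (hs : 0 < s) (hs1 : s < 1) (hη : IsMollifier η)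
    (hρ : ContDiff ℝ (⊤ : ℕ∞) ρ) (hL : LipschitzWith (1 / 2) ρ) :
    ∃ C : ℝ≥0∞, C ≠ ∞ ∧ ∀ (φ : EuclideanSpace ℝ (Fin n) → ℝ)
      (g : EuclideanSpace ℝ (Fin n) → EuclideanSpace ℝ (Fin n))
      (K : Set (EuclideanSpace ℝ (Fin n))),
      ContDiff ℝ (⊤ : ℕ∞) φ → HasCompactSupport φ → ContDiff ℝ (⊤ : ℕ∞) g → HasCompactSupport g →
      IsCompact K → (∀ x ∈ K, 0 < ρ x) →
      (∀ t ∈ Ioo (-(3 / 2) : ℝ) (3 / 2), ∀ x ∉ K, mollifyHomotopy η ρ φ (t, x) = 0) →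
      ‖∫ x, ∫ t in (0 : ℝ)..1, Matrix.det (Matrix.of fun j i : Fin (n + 1) =>
        fderiv ℝ ((Fin.cons (mollifyHomotopy η ρ φ) (fun i => mollifyHomotopy η ρ fun y => g y i) :
          Fin (n + 1) → _ → ℝ) i) (t, x) (slabFrame j))‖ₑ ≤
        C * ((∫⁻ x in K, localEnergy ρ (n / s) g x) ^ s *
          (∫⁻ x in K, localEnergy ρ (1 / (1 - s)) φ x) ^ (1 - s)) := by
  obtain ⟨C, hC, h⟩ := exists_abs_det_mollifyHomotopy_le hη hρ hL
  have h1 : 0 < 1 - s := by linarith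
  have hq : (1 : ℝ) ≤ n / s := by
    rw [le_div_iff₀ hs]
    have : (1 : ℝ) ≤ n := by exact_mod_cast hn
    linarith
  have hp : (1 : ℝ) ≤ 1 / (1 - s) := by rw [le_div_iff₀ h1]; linarith
  refine ⟨ENNReal.ofReal C * (ballConst n (n / s) ^ s * ballConst n (1 / (1 - s)) ^ (1 - s)),
    ENNReal.mul_ne_top ENNReal.ofReal_ne_top (ENNReal.mul_ne_top
      (ENNReal.rpow_ne_top_of_nonneg hs.le (ballConst_ne_top hq))
      (ENNReal.rpow_ne_top_of_nonneg h1.le (ballConst_ne_top hp))),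
    fun φ g K hφ hφc hg hgc hK hKρ hz => ?_⟩
  have hD := fun x hx => (h φ g hφ hφc hg hgc x hx).1
  set D : ℝ → EuclideanSpace ℝ (Fin n) → ℝ := fun t x => Matrix.det (Matrix.of
    fun j i : Fin (n + 1) => fderiv ℝ ((Fin.cons (mollifyHomotopy η ρ φ)
      (fun i => mollifyHomotopy η ρ fun y => g y i) : Fin (n + 1) → _ → ℝ) i) (t, x) (slabFrame j))
    with hDdef
  have hD0 : ∀ x ∉ K, ∫ t in (0 : ℝ)..1, D t x = 0 := by
    intro x hx
    refine (intervalIntegral.integral_congr fun t ht => ?_).trans intervalIntegral.integral_zero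
    rw [uIcc_of_le zero_le_one] at ht
    refine Matrix.det_eq_zero_of_column_eq_zero 0 fun j => ?_
    have ht' : t ∈ Ioo (-(3 / 2) : ℝ) (3 / 2) := ⟨by linarith [ht.1], by linarith [ht.2]⟩
    simp [fderiv_eq_zero_of_slab hK hz ht' hx]
  refine (enorm_integral_le_lintegral_enorm _).trans ?_
  have hind : ∫⁻ x, ‖∫ t in (0 : ℝ)..1, D t x‖ₑ = ∫⁻ x in K, ‖∫ t in (0 : ℝ)..1, D t x‖ₑ := by
    rw [← lintegral_indicator hK.measurableSet]
    refine lintegral_congr fun x => ?_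
    by_cases hx : x ∈ K
    · rw [indicator_of_mem hx]
    · rw [indicator_of_notMem hx, hD0 x hx, enorm_zero]
  rw [hind]
  have hpt : ∀ x ∈ K, ‖∫ t in (0 : ℝ)..1, D t x‖ₑ ≤ ENNReal.ofReal C *
      (ballConst n (n / s) ^ s * ballConst n (1 / (1 - s)) ^ (1 - s)) *
        (localEnergy ρ (n / s) g x ^ s * localEnergy ρ (1 / (1 - s)) φ x ^ (1 - s)) := by
    intro x hx
    have hx' := hKρ x hx
    rw [intervalIntegral.integral_of_le zero_le_one, mul_assoc,
      ← ennreal_const_mul_rpow _ _ _ _ hs.le hs1.le]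
    refine (enorm_integral_le_lintegral_enorm _).trans ?_
    refine le_trans ?_ (mul_le_mul_right (lintegral_scales_interpolation_le hn hs hs1 hg.continuous
      hφ.continuous hx') _)
    rw [← lintegral_const_mul' _ _ ENNReal.ofReal_ne_top]
    refine setLIntegral_mono' measurableSet_Ioc fun t ht => ?_
    rw [← ENNReal.ofReal_mul hC, Real.enorm_eq_ofReal_abs]
    exact ENNReal.ofReal_le_ofReal (hD x hx' t ht)
  refine (setLIntegral_mono' hK.measurableSet hpt).trans ?_
  have mg := measurable_localEnergy hρ.continuous hg.continuous ((n : ℝ) / s)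
  have mφ := measurable_localEnergy hρ.continuous hφ.continuous (1 / (1 - s))
  rw [lintegral_const_mul _ (by fun_prop)]
  exact mul_le_mul_right (ENNReal.lintegral_mul_norm_pow_le mg.aemeasurable mφ.aemeasurable hs.le
    h1.le (by ring)) _

/-- The boundary term of the homotopy formula, by Hardy's inequality. -/
theorem exists_boundary_estimate (hn : 2 ≤ n) {s : ℝ} (hs : 0 < s) (hs1 : s < 1)
    {Ω : Set (EuclideanSpace ℝ (Fin n))} (hΩo : IsOpen Ω) (hΩb : Bornology.IsBounded Ω)
    (hη : IsMollifier η) (hρ : ContDiff ℝ (⊤ : ℕ∞) ρ) (hρc : HasCompactSupport ρ)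
    (hL : LipschitzWith (1 / 2) ρ) (hΩ : ∀ x, x ∈ Ω ↔ 0 < ρ x)
    (hd : ∀ x ∈ frontier Ω, fderiv ℝ ρ x ≠ 0) :
    ∃ C : ℝ≥0∞, C ≠ ∞ ∧ ∀ (φ : EuclideanSpace ℝ (Fin n) → ℝ)
      (g : EuclideanSpace ℝ (Fin n) → EuclideanSpace ℝ (Fin n))
      (K : Set (EuclideanSpace ℝ (Fin n))),
      ContDiff ℝ (⊤ : ℕ∞) φ → HasCompactSupport φ → ContDiff ℝ (⊤ : ℕ∞) g → HasCompactSupport g →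
      IsCompact K → (∀ x ∈ K, 0 < ρ x) →
      (∀ t ∈ Ioo (-(3 / 2) : ℝ) (3 / 2), ∀ x ∉ K, mollifyHomotopy η ρ φ (t, x) = 0) →
      ‖∫ x, mollifyHomotopy η ρ φ (1, x) * Matrix.det (Matrix.of fun j i : Fin n =>
        fderiv ℝ (mollifyHomotopy η ρ fun y => g y i) (1, x) (0, stdVec j))‖ₑ ≤
        C * ((∫⁻ x in K, localEnergy ρ (n / s) g x) ^ s *
          (∫⁻ x in K, localEnergy ρ (1 / (1 - s)) φ x) ^ (1 - s)) := by
  obtain ⟨C, hC, h⟩ := exists_abs_det_mollifyHomotopy_le hη hρ hL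
  have h1 : 0 < 1 - s := by linarith
  have hq : (1 : ℝ) ≤ n / s := by
    rw [le_div_iff₀ hs]
    have : (2 : ℝ) ≤ n := by exact_mod_cast hn
    linarith
  have hp : (1 : ℝ) < 1 / (1 - s) := by rw [lt_div_iff₀ h1]; linarith
  obtain ⟨H, hH, hardy⟩ := exists_hardy hn hΩo hΩb hρ hρc hΩ hd hp
  set q : ℝ := n / s with hqdef
  set p : ℝ := 1 / (1 - s) with hpdef
  have hp0 : 0 < p := by linarith
  have hps : 1 / p = 1 - s := by rw [hpdef, one_div_one_div]
  rw [hps] at hardy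
  refine ⟨ENNReal.ofReal C * (ENNReal.ofReal H * (ballConst n q ^ s *
      (ENNReal.ofReal (C ^ p) * ballConst n p) ^ (1 - s))),
    ENNReal.mul_ne_top ENNReal.ofReal_ne_top (ENNReal.mul_ne_top ENNReal.ofReal_ne_top
      (ENNReal.mul_ne_top (ENNReal.rpow_ne_top_of_nonneg hs.le (ballConst_ne_top hq))
      (ENNReal.rpow_ne_top_of_nonneg h1.le
        (ENNReal.mul_ne_top ENNReal.ofReal_ne_top (ballConst_ne_top hp.le))))),
    fun φ g K hφ hφc hg hgc hK hKρ hz => ?_⟩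
  have hDet := fun x hx => (h φ g hφ hφc hg hgc x hx).2.1
  have hGrad := fun x hx => (h φ g hφ hφc hg hgc x hx).2.2
  set u : EuclideanSpace ℝ (Fin n) → ℝ := fun x => mollifyHomotopy η ρ φ (1, x) with hu_def
  set J : EuclideanSpace ℝ (Fin n) → ℝ := fun x => Matrix.det (Matrix.of fun j i : Fin n =>
        fderiv ℝ (mollifyHomotopy η ρ fun y => g y i) (1, x) (0, stdVec j)) with hJ_def
  have hu : ContDiff ℝ 1 u := ((contDiff_mollifyHomotopy hη hρ hφ).comp
    (contDiff_const.prodMk contDiff_id)).of_le (by simp)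
  have hu0 : ∀ x ∉ K, u x = 0 := hz 1 (by norm_num)
  have huK : tsupport u ⊆ K := closure_minimal
    (fun x hx => by_contra fun h => hx (hu0 x h)) hK.isClosed
  have hKΩ : K ⊆ Ω := fun x hx => (hΩ x).2 (hKρ x hx)
  have hgrad0 : ∀ x ∉ K, fderiv ℝ u x = 0 := fun x hx =>
    image_eq_zero_of_notMem_tsupport fun h => hx (huK (tsupport_fderiv_subset ℝ h))
  have hB : ∀ {F : Type} [NormedAddCommGroup F] (v : EuclideanSpace ℝ (Fin n) → F), ∀ x ∈ K,
      0 ≤ (ρ x)⁻¹ * osc v (ρ x) x := fun v x hx =>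
    mul_nonneg (inv_pos.2 (hKρ x hx)).le (osc_nonneg v _ _)
  have hoscm : ∀ {F : Type} [NormedAddCommGroup F] {v : EuclideanSpace ℝ (Fin n) → F},
      Continuous v → Measurable fun x => (ρ x)⁻¹ * osc v (ρ x) x := fun hv =>
    hρ.continuous.measurable.inv.mul ((continuous_osc hv).comp
      (hρ.continuous.prodMk continuous_id)).measurable
  have mX : Measurable fun x => ENNReal.ofReal (ρ x ^ (q - n) * ((ρ x)⁻¹ * osc g (ρ x) x) ^ q) :=
    ((hρ.continuous.measurable.pow_const _).mul ((hoscm hg.continuous).pow_const q)).ennreal_ofReal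
  have mY : Measurable fun x => ENNReal.ofReal (|u x| ^ p * ρ x ^ (-(n : ℝ))) :=
    ((hu.continuous.measurable.norm.pow_const p).mul
      (hρ.continuous.measurable.pow_const _)).ennreal_ofReal
  have step1 : ‖∫ x, u x * J x‖ₑ ≤ ENNReal.ofReal C * ∫⁻ x in K,
      ENNReal.ofReal (ρ x ^ (q - n) * ((ρ x)⁻¹ * osc g (ρ x) x) ^ q) ^ s *
        ENNReal.ofReal (|u x| ^ p * ρ x ^ (-(n : ℝ))) ^ (1 - s) := by
    rw [← setIntegral_eq_integral_of_forall_compl_eq_zero (s := K)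
      fun x hx => by rw [hu0 x hx, zero_mul]]
    refine (enorm_integral_le_lintegral_enorm _).trans ?_
    rw [← lintegral_const_mul' _ _ ENNReal.ofReal_ne_top]
    refine setLIntegral_mono' hK.measurableSet fun x hx => ?_
    have hx' := hKρ x hx
    have hb := hB g x hx
    rw [ENNReal.ofReal_rpow_of_nonneg (by positivity) hs.le,
      ENNReal.ofReal_rpow_of_nonneg (by positivity) h1.le, ← ENNReal.ofReal_mul (by positivity),
      ← pow_mul_eq_interpolation hs hs1 hx' hb (abs_nonneg (u x)), ← ENNReal.ofReal_mul hC,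
      Real.enorm_eq_ofReal_abs, abs_mul]
    refine ENNReal.ofReal_le_ofReal ?_
    have := mul_le_mul_of_nonneg_left (hDet x hx') (abs_nonneg (u x))
    linarith
  have stepX : ∫⁻ x in K, ENNReal.ofReal (ρ x ^ (q - n) * ((ρ x)⁻¹ * osc g (ρ x) x) ^ q) ≤
      ballConst n q * ∫⁻ x in K, localEnergy ρ q g x := by
    rw [← lintegral_const_mul _ (measurable_localEnergy hρ.continuous hg.continuous q)]
    exact setLIntegral_mono' hK.measurableSet fun x hx =>
      osc_single_scale_le hg.continuous hq (hKρ x hx) x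
  have stepG : ∫⁻ x in Ω, ENNReal.ofReal (ρ x ^ (p - n) * ‖fderiv ℝ u x‖ ^ p) ≤
      ENNReal.ofReal (C ^ p) * ballConst n p * ∫⁻ x in K, localEnergy ρ p φ x := by
    have hind : ∫⁻ x in Ω, ENNReal.ofReal (ρ x ^ (p - n) * ‖fderiv ℝ u x‖ ^ p) =
        ∫⁻ x in K, ENNReal.ofReal (ρ x ^ (p - n) * ‖fderiv ℝ u x‖ ^ p) := by
      rw [← lintegral_indicator hK.measurableSet, ← lintegral_indicator hΩo.measurableSet]
      refine lintegral_congr fun x => ?_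
      by_cases hx : x ∈ K
      · rw [indicator_of_mem hx, indicator_of_mem (hKΩ hx)]
      · rw [indicator_of_notMem hx]
        refine indicator_apply_eq_zero.2 fun _ => ?_
        simp [hgrad0 x hx, Real.zero_rpow hp0.ne']
    rw [hind, mul_assoc, ← lintegral_const_mul _ (measurable_localEnergy hρ.continuous
      hφ.continuous p), ← lintegral_const_mul' _ _ ENNReal.ofReal_ne_top]
    refine setLIntegral_mono' hK.measurableSet fun x hx => ?_
    have hx' := hKρ x hx
    refine le_trans ?_ (mul_le_mul_right
      (osc_single_scale_le hφ.continuous hp.le hx' x) (ENNReal.ofReal (C ^ p)))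
    rw [← ENNReal.ofReal_mul (by positivity)]
    refine ENNReal.ofReal_le_ofReal ?_
    have := Real.rpow_le_rpow (norm_nonneg _) (hGrad x hx') hp0.le
    rw [Real.mul_rpow hC (hB φ x hx)] at this
    calc _ ≤ ρ x ^ (p - n) * (C ^ p * ((ρ x)⁻¹ * osc φ (ρ x) x) ^ p) :=
          mul_le_mul_of_nonneg_left this (by positivity)
      _ = _ := by ring
  have stepY : (∫⁻ x in K, ENNReal.ofReal (|u x| ^ p * ρ x ^ (-(n : ℝ)))) ^ (1 - s) ≤
      ENNReal.ofReal H * (ENNReal.ofReal (C ^ p) * ballConst n p *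
        ∫⁻ x in K, localEnergy ρ p φ x) ^ (1 - s) :=
    (ENNReal.rpow_le_rpow (lintegral_mono_set hKΩ) h1.le).trans
      ((hardy u hu (HasCompactSupport.intro hK hu0) (huK.trans hKΩ)).trans
        (mul_le_mul_right (ENNReal.rpow_le_rpow stepG h1.le) _))
  refine step1.trans ?_
  rw [mul_assoc]
  refine mul_le_mul_right ?_ _
  refine (ENNReal.lintegral_mul_norm_pow_le mX.aemeasurable mY.aemeasurable hs.le h1.le
    (by ring)).trans ?_
  refine (mul_le_mul' (ENNReal.rpow_le_rpow stepX hs.le) stepY).trans_eq ?_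
  rw [mul_left_comm, ennreal_const_mul_rpow _ _ _ _ hs.le hs1.le]
  ring

end Estimates

section Assembly

variable {n : ℕ} {η ρ : EuclideanSpace ℝ (Fin n) → ℝ} {Ω : Set (EuclideanSpace ℝ (Fin n))}

theorem LipschitzWith.le_two_mul_of_mem_closedBall (hL : LipschitzWith (1 / 2) ρ)
    {x y : EuclideanSpace ℝ (Fin n)} (hy : y ∈ closedBall x (ρ x)) : ρ x ≤ 2 * ρ y := by
  have h := (le_abs_self _).trans (hL.dist_le_mul x y)
  rw [mem_closedBall, dist_comm] at hy
  push_cast at h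
  linarith

theorem mollifyHomotopy_eq_zero (hη : IsMollifier η) (hL : LipschitzWith (1 / 2) ρ)
    {φ : EuclideanSpace ℝ (Fin n) → ℝ} {δ : ℝ} (hδ : 0 < δ) (hφ : ∀ x, φ x ≠ 0 → δ ≤ ρ x) {t : ℝ}
    (ht : t ∈ Ioo (-(3 / 2) : ℝ) (3 / 2)) {x : EuclideanSpace ℝ (Fin n)} (hx : ¬δ / 2 ≤ ρ x) :
    mollifyHomotopy η ρ φ (t, x) = 0 := by
  refine integral_eq_zero_of_ae (ae_of_all _ fun z => ?_)
  by_cases hz : z ∈ closedBall (0 : EuclideanSpace ℝ (Fin n)) 1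
  swap
  · simp [hη.eq_zero z hz]
  by_contra hne
  have h1 := hφ _ (left_ne_zero_of_mul hne)
  have h2 := (le_abs_self _).trans (hL.dist_le_mul (x + (t * ρ x) • z) x)
  rw [dist_self_add_left, norm_smul, Real.norm_eq_abs, abs_mul] at h2
  push_cast at h2
  have h3 : |t| * |ρ x| * ‖z‖ ≤ 3 / 2 * |ρ x| := by
    have h4 : |t| ≤ 3 / 2 := (abs_lt.2 ht).le
    have h5 : ‖z‖ ≤ 1 := by simpa using hz
    calc |t| * |ρ x| * ‖z‖ ≤ |t| * |ρ x| * 1 := by gcongr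
      _ ≤ _ := by rw [mul_one]; gcongr
  simp only at h1
  rcases le_total 0 (ρ x) with h | h
  · rw [abs_of_nonneg h] at h2 h3
    linarith
  · rw [abs_of_nonpos h] at h2 h3
    linarith

theorem fderiv_mollifyHomotopy_zero (hη : IsMollifier η) (hρ : ContDiff ℝ (⊤ : ℕ∞) ρ)
    {u : EuclideanSpace ℝ (Fin n) → ℝ} (hu : ContDiff ℝ (⊤ : ℕ∞) u)
    (x v : EuclideanSpace ℝ (Fin n)) :
    fderiv ℝ (mollifyHomotopy η ρ u) (0, x) (0, v) = fderiv ℝ u x v := by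
  have hd : HasFDerivAt (fun y => mollifyHomotopy η ρ u (0, y)) _ x :=
    ((contDiff_mollifyHomotopy hη hρ hu).differentiable (by simp) (0, x)).hasFDerivAt.comp x
      (hasFDerivAt_prodMk_right 0 x)
  have : (fun y => mollifyHomotopy η ρ u (0, y)) = u := funext fun y => mollifyHomotopy_zero hη y
  rw [this] at hd
  rw [hd.fderiv]
  simp

theorem exists_det_estimate (hn : 2 ≤ n) {s : ℝ} (hs : 0 < s) (hs1 : s < 1)
    (hΩo : IsOpen Ω) (hΩb : Bornology.IsBounded Ω)
    (hη : IsMollifier η) (hρ : ContDiff ℝ (⊤ : ℕ∞) ρ) (hρc : HasCompactSupport ρ)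
    (hL : LipschitzWith (1 / 2) ρ) (hΩ : ∀ x, x ∈ Ω ↔ 0 < ρ x)
    (hd : ∀ x ∈ frontier Ω, fderiv ℝ ρ x ≠ 0) :
    ∃ C : ℝ≥0∞, C ≠ ∞ ∧ ∀ (φ : EuclideanSpace ℝ (Fin n) → ℝ)
      (g : EuclideanSpace ℝ (Fin n) → EuclideanSpace ℝ (Fin n)) (δ : ℝ),
      ContDiff ℝ (⊤ : ℕ∞) φ → HasCompactSupport φ → ContDiff ℝ (⊤ : ℕ∞) g → HasCompactSupport g →
      0 < δ → (∀ x, φ x ≠ 0 → δ ≤ ρ x) →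
      ‖∫ x, φ x * (fderiv ℝ g x).det‖ₑ ≤
        C * ((∫⁻ x in {x | δ / 2 ≤ ρ x}, localEnergy ρ (n / s) g x) ^ s *
          (∫⁻ x in {x | δ / 2 ≤ ρ x}, localEnergy ρ (1 / (1 - s)) φ x) ^ (1 - s)) := by
  obtain ⟨C₁, hC₁, h₁⟩ := exists_bulk_estimate (by omega) hs hs1 hη hρ hL
  obtain ⟨C₂, hC₂, h₂⟩ := exists_boundary_estimate hn hs hs1 hΩo hΩb hη hρ hρc hL hΩ hd
  refine ⟨C₂ + C₁, ENNReal.add_ne_top.2 ⟨hC₂, hC₁⟩, fun φ g δ hφ hφc hg hgc hδ hφρ => ?_⟩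
  have hK : IsCompact {x | δ / 2 ≤ ρ x} :=
    hρc.isCompact.of_isClosed_subset (isClosed_le continuous_const hρ.continuous)
      fun x (hx : δ / 2 ≤ ρ x) => subset_tsupport _ (by
        simp only [Function.mem_support]
        linarith)
  have hKρ : ∀ x ∈ {x | δ / 2 ≤ ρ x}, 0 < ρ x := fun x (hx : δ / 2 ≤ ρ x) => by linarith
  have hz : ∀ t ∈ Ioo (-(3 / 2) : ℝ) (3 / 2), ∀ x ∉ {x | δ / 2 ≤ ρ x},
      mollifyHomotopy η ρ φ (t, x) = 0 := fun t ht x hx =>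
    mollifyHomotopy_eq_zero hη hL hδ hφρ ht hx
  have hgi : ∀ i : Fin n, ContDiff ℝ (⊤ : ℕ∞) fun y => g y i := fun i => by fun_prop
  have h := integral_det_slab (G := fun i => mollifyHomotopy η ρ fun y => g y i)
    ((contDiff_mollifyHomotopy hη hρ hφ).of_le (WithTop.coe_le_coe.2 (le_top : (2 : ℕ∞) ≤ ⊤)))
    (fun i => (contDiff_mollifyHomotopy hη hρ (hgi i)).of_le (WithTop.coe_le_coe.2 (le_top : (2 : ℕ∞) ≤ ⊤))) hK hz
  have h0 : ∀ x, mollifyHomotopy η ρ φ (0, x) * Matrix.det (Matrix.of fun j i : Fin n =>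
      fderiv ℝ (mollifyHomotopy η ρ fun y => g y i) (0, x) (0, stdVec j)) =
      φ x * (fderiv ℝ g x).det := by
    intro x
    rw [mollifyHomotopy_zero hη, clm_det_eq]
    congr 2
    ext j i
    simp only [Matrix.of_apply]
    rw [fderiv_mollifyHomotopy_zero hη hρ (hgi i)]
    have := ((EuclideanSpace.proj i : EuclideanSpace ℝ (Fin n) →L[ℝ] ℝ).hasFDerivAt.comp x
      (hg.differentiable (by simp) x).hasFDerivAt).fderiv
    exact congrArg (fun T => T (stdVec j)) this
  simp only [h0] at h
  rw [eq_sub_iff_add_eq, ← eq_sub_iff_add_eq'] at h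
  rw [h, add_mul]
  exact enorm_sub_le.trans (add_le_add (h₂ φ g _ hφ hφc hg hgc hK hKρ hz)
    (h₁ φ g _ hφ hφc hg hgc hK hKρ hz))

/-- A function smooth near the set `{0 < ρ}` agrees on `{δ ≤ ρ}` with a test function. -/
theorem exists_contDiff_hasCompactSupport_eq {F : Type*} [NormedAddCommGroup F] [NormedSpace ℝ F]
    (hρ : ContDiff ℝ (⊤ : ℕ∞) ρ) (hρc : HasCompactSupport ρ)
    {f : EuclideanSpace ℝ (Fin n) → F} (hf : ContDiffOn ℝ (⊤ : ℕ∞) f {x | 0 < ρ x})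
    {δ : ℝ} (hδ : 0 < δ) :
    ∃ g : EuclideanSpace ℝ (Fin n) → F, ContDiff ℝ (⊤ : ℕ∞) g ∧ HasCompactSupport g ∧
      ∀ x, δ ≤ ρ x → g x = f x := by
  set χ : EuclideanSpace ℝ (Fin n) → ℝ := fun x =>
    Real.smoothTransition ((ρ x - δ / 2) / (δ / 2)) with hχ_def
  have hχ : ContDiff ℝ (⊤ : ℕ∞) χ :=
    Real.smoothTransition.contDiff.comp ((hρ.sub contDiff_const).div_const _)
  have h0 : ∀ x, ρ x ≤ δ / 2 → χ x = 0 := fun x hx =>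
    Real.smoothTransition.zero_of_nonpos (div_nonpos_of_nonpos_of_nonneg (by linarith) (by linarith))
  refine ⟨fun x => χ x • f x, contDiff_iff_contDiffAt.2 fun x => ?_,
    hρc.mono fun x hx hx0 => hx ?_, fun x hx => ?_⟩
  · rcases lt_or_ge 0 (ρ x) with h | h
    · exact hχ.contDiffAt.smul (hf.contDiffAt
        ((isOpen_lt continuous_const hρ.continuous).mem_nhds h))
    · refine (contDiffAt_const (c := (0 : F))).congr_of_eventuallyEq ?_
      filter_upwards [(isOpen_lt hρ.continuous continuous_const).mem_nhds
        (show ρ x < δ / 2 by linarith)] with y hy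
      rw [h0 y (le_of_lt hy), zero_smul]
  · simp only at hx0 ⊢
    rw [h0 x (by linarith), zero_smul]
  · have : χ x = 1 := Real.smoothTransition.one_of_one_le (by rw [le_div_iff₀ (by linarith)]; linarith)
    simp only [this, one_smul]

theorem setLIntegral_localEnergy_le {F : Type*} [NormedAddCommGroup F] (hρ : Continuous ρ)
    (hL : LipschitzWith (1 / 2) ρ) (hΩ : ∀ x, x ∈ Ω ↔ 0 < ρ x)
    {f g : EuclideanSpace ℝ (Fin n) → F} {δ : ℝ} (hδ : 0 < δ) (hfg : ∀ x, δ / 4 ≤ ρ x → g x = f x)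
    (q : ℝ) :
    ∫⁻ x in {x | δ / 2 ≤ ρ x}, localEnergy ρ q g x ≤
      ∫⁻ x in Ω, ∫⁻ y in Ω, gagliardoKernel q f x y := by
  have hK : MeasurableSet {x | δ / 2 ≤ ρ x} := (isClosed_le continuous_const hρ).measurableSet
  refine (setLIntegral_mono' hK fun x (hx : δ / 2 ≤ ρ x) => ?_).trans
    (lintegral_mono_set fun x (hx : δ / 2 ≤ ρ x) => (hΩ x).2 (by linarith))
  have hball : ∀ y ∈ closedBall x (ρ x), δ / 4 ≤ ρ y := fun y hy => by
    have := hL.le_two_mul_of_mem_closedBall hy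
    linarith
  refine (setLIntegral_mono' measurableSet_closedBall fun y hy => ?_).trans
    (lintegral_mono_set fun y hy => (hΩ y).2 (by linarith [hball y hy]))
  rw [gagliardoKernel, gagliardoKernel, hfg x (by linarith), hfg y (hball y hy)]

theorem gagliardoSeminorm_eq {F : Type*} [NormedAddCommGroup F] {σ p : ℝ} (h : σ * p = n)
    (f : EuclideanSpace ℝ (Fin n) → F) :
    gagliardoSeminorm n σ p Ω f =
      (∫⁻ x in Ω, ∫⁻ y in Ω, gagliardoKernel p f x y) ^ (1 / p) := by
  rw [gagliardoSeminorm, h, ← two_mul]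
  rfl

end Assembly

/-- **A priori estimate for the distributional Jacobian** (Lemma 1.3, a priori part):
for `s ∈ ((n-1)/n, 1)` there is `C = C(n,s,Ω)` with
`|∫_Ω det(Df) φ| ≤ C [f]_{W^{s,n/s}(Ω)}ⁿ [φ]_{W^{(1-s)n,1/(1-s)}(Ω)}`
for all `f ∈ C^∞(cl Ω, ℝⁿ)` and `φ ∈ C_c^∞(Ω)`. -/
theorem jacobian_apriori_estimate (n : ℕ) (hn : 2 ≤ n)
    (Ω : Set (EuclideanSpace ℝ (Fin n))) (hΩo : IsOpen Ω)
    (hΩb : Bornology.IsBounded Ω) (hΩs : HasSmoothBoundary n Ω)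
    (s : ℝ) (hs : ((n : ℝ) - 1) / n < s) (hs1 : s < 1) :
    ∃ C : ℝ, 0 < C ∧
      ∀ f : EuclideanSpace ℝ (Fin n) → EuclideanSpace ℝ (Fin n),
        ContDiffOn ℝ (⊤ : ℕ∞) f (closure Ω) →
        ∀ φ : EuclideanSpace ℝ (Fin n) → ℝ, IsTestFunction n Ω φ →
          ENNReal.ofReal |∫ x in Ω, (fderiv ℝ f x).det * φ x| ≤
            ENNReal.ofReal C * gagliardoSeminorm n s ((n : ℝ) / s) Ω f ^ (n : ℝ) *
              gagliardoSeminorm n ((1 - s) * n) (1 / (1 - s)) Ω φ := by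
  have hn' : (2 : ℝ) ≤ n := by exact_mod_cast hn
  have hs0 : 0 < s := lt_of_le_of_lt (div_nonneg (by linarith) (by linarith)) hs
  have h1 : 0 < 1 - s := by linarith
  obtain ⟨ρ, hρ, hρc, hL, hΩ, hd⟩ := hΩs.exists_defining hΩo hΩb
  obtain ⟨η, hη⟩ := exists_isMollifier n
  obtain ⟨C, hC, h⟩ := exists_det_estimate hn hs0 hs1 hΩo hΩb hη hρ hρc hL hΩ hd
  refine ⟨C.toReal + 1, by positivity, fun f hf φ ⟨hφ, hφc, hφΩ⟩ => ?_⟩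
  obtain ⟨δ, hδ, hδφ⟩ := hφc.isCompact.exists_forall_le' hρ.continuous.continuousOn
    (fun x hx => (hΩ x).1 (hφΩ hx))
  have hΩ_eq : Ω = {x | 0 < ρ x} := Set.ext hΩ
  obtain ⟨g, hg, hgc, hgf⟩ := exists_contDiff_hasCompactSupport_eq hρ hρc
    (hΩ_eq ▸ hf.mono subset_closure) (show 0 < δ / 4 by linarith)
  have hint : ∫ x in Ω, (fderiv ℝ f x).det * φ x = ∫ x, φ x * (fderiv ℝ g x).det := by
    refine (setIntegral_congr_fun hΩo.measurableSet fun x _ => ?_).trans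
      (setIntegral_eq_integral_of_forall_compl_eq_zero (s := Ω) fun x hx => by
        rw [image_eq_zero_of_notMem_tsupport fun h => hx (hφΩ h), zero_mul])
    by_cases hx : x ∈ tsupport φ
    · have : g =ᶠ[𝓝 x] f := by
        filter_upwards [(isOpen_lt continuous_const hρ.continuous).mem_nhds
          (show δ / 4 < ρ x by linarith [hδφ x hx])] with y hy using hgf y (le_of_lt hy)
      simp only [this.fderiv_eq, mul_comm]
    · simp [image_eq_zero_of_notMem_tsupport hx]
  rw [hint, ← Real.enorm_eq_ofReal_abs]
  refine (h φ g δ hφ hφc hg hgc hδ fun x hx => hδφ x (subset_tsupport _ hx)).trans ?_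
  rw [gagliardoSeminorm_eq (by field_simp), gagliardoSeminorm_eq (by field_simp),
    ← ENNReal.rpow_mul, one_div_one_div, mul_assoc,
    show 1 / ((n : ℝ) / s) * n = s by field_simp]
  refine mul_le_mul' ((ENNReal.ofReal_toReal hC).symm.le.trans
    (ENNReal.ofReal_le_ofReal (by linarith))) (mul_le_mul' ?_ ?_)
  · exact ENNReal.rpow_le_rpow
      (setLIntegral_localEnergy_le hρ.continuous hL hΩ hδ hgf _) hs0.le
  · exact ENNReal.rpow_le_rpow
      (setLIntegral_localEnergy_le hρ.continuous hL hΩ hδ (fun _ _ => rfl) _) h1.le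

end
end

section
/- For every c > 0 there exists a function d : [0,∞) → (0,∞) of class C^{1,1} (i.e. differentiable with Lipschitz continuous derivative) such that: (i) d(t) + t·d'(t) ≥ 0 for all t > 0; (ii) d(t) = 1/t for all t > c/2; (iii) there exists ε > 0 such that d(t) = d(0) for all t ∈ [0, ε]; and (iv) there exists ε' > 0 such that d(t) + t·d'(t) > 0 for all t ∈ [0, ε']. -/
open Set

theorem hasDerivAt_max_zero_sq (x : ℝ) :
    HasDerivAt (fun y : ℝ => max y 0 ^ 2) (2 * max x 0) x := by
  rcases lt_trichotomy x 0 with hx | rfl | hx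
  · rw [max_eq_right hx.le, mul_zero]
    refine (hasDerivAt_const x (0 : ℝ)).congr_of_eventuallyEq ?_
    filter_upwards [Iio_mem_nhds hx] with y hy
    simp [max_eq_right (le_of_lt (mem_Iio.1 hy))]
  · have h : (fun y : ℝ => max y 0 ^ 2) =O[nhds 0] fun y => ‖y - 0‖ ^ 2 := by
      refine Asymptotics.IsBigO.of_bound 1 (Filter.Eventually.of_forall fun y => ?_)
      rcases le_total y 0 with hy | hy <;> simp [hy, sq_nonneg]
    have := (h.hasFDerivAt one_lt_two).hasDerivAt
    simpa using this
  · rw [max_eq_left hx.le]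
    have h : HasDerivAt (fun y : ℝ => y ^ 2) (2 * x) x := by simpa using hasDerivAt_pow 2 x
    refine h.congr_of_eventuallyEq ?_
    filter_upwards [Ioi_mem_nhds hx] with y hy
    simp [max_eq_left (le_of_lt (mem_Ioi.1 hy))]

/-- A convex `C^{1,1}` function equal to `3 s / 2` on `(-∞, s]` and to the identity
on `[2 s, ∞)`. -/
noncomputable def smoothedMax (s t : ℝ) : ℝ :=
  3 * s / 2 + (max (t - s) 0 ^ 2 - max (t - 2 * s) 0 ^ 2) / (2 * s)

/-- The derivative of `smoothedMax s`. -/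
noncomputable def smoothedMaxDeriv (s t : ℝ) : ℝ :=
  (max (t - s) 0 - max (t - 2 * s) 0) / s

section

variable {s : ℝ}

theorem smoothedMax_of_le (hs : 0 < s) {t : ℝ} (ht : t ≤ s) : smoothedMax s t = 3 * s / 2 := by
  rw [smoothedMax, max_eq_right (by linarith), max_eq_right (by linarith)]
  simp

theorem smoothedMax_of_mem_Icc {t : ℝ} (ht : t ∈ Icc s (2 * s)) :
    smoothedMax s t = 3 * s / 2 + (t - s) ^ 2 / (2 * s) := by
  rw [smoothedMax, max_eq_left (by linarith [ht.1]), max_eq_right (by linarith [ht.2])]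
  simp

theorem smoothedMax_of_ge (hs : 0 < s) {t : ℝ} (ht : 2 * s ≤ t) : smoothedMax s t = t := by
  rw [smoothedMax, max_eq_left (by linarith), max_eq_left (by linarith)]
  field_simp
  ring

theorem smoothedMaxDeriv_of_le (hs : 0 < s) {t : ℝ} (ht : t ≤ s) : smoothedMaxDeriv s t = 0 := by
  rw [smoothedMaxDeriv, max_eq_right (by linarith), max_eq_right (by linarith)]
  simp

theorem smoothedMaxDeriv_of_mem_Icc {t : ℝ} (ht : t ∈ Icc s (2 * s)) :
    smoothedMaxDeriv s t = (t - s) / s := by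
  rw [smoothedMaxDeriv, max_eq_left (by linarith [ht.1]), max_eq_right (by linarith [ht.2])]
  simp

theorem smoothedMaxDeriv_of_ge (hs : 0 < s) {t : ℝ} (ht : 2 * s ≤ t) :
    smoothedMaxDeriv s t = 1 := by
  rw [smoothedMaxDeriv, max_eq_left (by linarith), max_eq_left (by linarith)]
  field_simp
  ring

theorem hasDerivAt_smoothedMax (hs : 0 < s) (t : ℝ) :
    HasDerivAt (smoothedMax s) (smoothedMaxDeriv s t) t := by
  have h (a : ℝ) : HasDerivAt (fun y : ℝ => max (y - a) 0 ^ 2) (2 * max (t - a) 0) t := by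
    simpa using (hasDerivAt_max_zero_sq (t - a)).comp_sub_const t a
  refine ((((h s).sub (h (2 * s))).div_const (2 * s)).const_add (3 * s / 2)).congr_deriv ?_
  rw [smoothedMaxDeriv]
  field_simp

theorem le_smoothedMax (hs : 0 < s) (t : ℝ) : 3 * s / 2 ≤ smoothedMax s t := by
  have h : max (t - 2 * s) 0 ≤ max (t - s) 0 := max_le_max_right _ (by linarith)
  have h' : max (t - 2 * s) 0 ^ 2 ≤ max (t - s) 0 ^ 2 :=
    pow_le_pow_left₀ (le_max_right _ _) h 2
  rw [smoothedMax, le_add_iff_nonneg_right]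
  exact div_nonneg (sub_nonneg.2 h') (by linarith)

theorem smoothedMax_pos (hs : 0 < s) (t : ℝ) : 0 < smoothedMax s t :=
  lt_of_lt_of_le (by positivity) (le_smoothedMax hs t)

theorem smoothedMaxDeriv_mem_Icc (hs : 0 < s) (t : ℝ) : smoothedMaxDeriv s t ∈ Icc 0 1 := by
  rw [smoothedMaxDeriv, mem_Icc, le_div_iff₀ hs, div_le_one hs]
  rcases max_cases (t - s) 0 with h | h <;> rcases max_cases (t - 2 * s) 0 with h' | h' <;>
    constructor <;> linarith

theorem abs_smoothedMaxDeriv_sub_le (hs : 0 < s) (x y : ℝ) :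
    |smoothedMaxDeriv s x - smoothedMaxDeriv s y| ≤ 2 / s * |x - y| := by
  have h (a : ℝ) : |max (x - a) 0 - max (y - a) 0| ≤ |x - y| := by
    simpa using abs_max_sub_max_le_abs (x - a) (y - a) 0
  rw [smoothedMaxDeriv, smoothedMaxDeriv, ← sub_div, abs_div, abs_of_pos hs, div_mul_eq_mul_div]
  gcongr
  have h₁ := abs_le.1 (h s)
  have h₂ := abs_le.1 (h (2 * s))
  rw [abs_le]
  constructor <;> linarith

theorem abs_smoothedMax_sub_le (hs : 0 < s) (x y : ℝ) :
    |smoothedMax s x - smoothedMax s y| ≤ |x - y| := by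
  have := convex_univ.norm_image_sub_le_of_norm_hasDerivWithin_le (C := 1)
    (fun t _ => (hasDerivAt_smoothedMax hs t).hasDerivWithinAt)
    (fun t _ => by
      have := smoothedMaxDeriv_mem_Icc hs t
      rw [Real.norm_of_nonneg this.1]
      exact this.2) (mem_univ y) (mem_univ x)
  simpa using this

theorem mul_smoothedMaxDeriv_le (hs : 0 < s) (t : ℝ) :
    t * smoothedMaxDeriv s t ≤ smoothedMax s t := by
  rcases le_total t s with h | h
  · rw [smoothedMaxDeriv_of_le hs h, mul_zero]
    exact (smoothedMax_pos hs t).le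
  rcases le_total t (2 * s) with h' | h'
  · rw [smoothedMaxDeriv_of_mem_Icc ⟨h, h'⟩, smoothedMax_of_mem_Icc ⟨h, h'⟩, ← sub_nonneg]
    have : 3 * s / 2 + (t - s) ^ 2 / (2 * s) - t * ((t - s) / s)
        = (2 * s - t) * (2 * s + t) / (2 * s) := by
      field_simp
      ring
    rw [this]
    exact div_nonneg (mul_nonneg (by linarith) (by linarith)) (by linarith)
  · rw [smoothedMaxDeriv_of_ge hs h', smoothedMax_of_ge hs h', mul_one]

theorem hasDerivAt_inv_smoothedMax (hs : 0 < s) (t : ℝ) :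
    HasDerivAt (fun t => (smoothedMax s t)⁻¹) (-smoothedMaxDeriv s t / smoothedMax s t ^ 2) t :=
  (hasDerivAt_smoothedMax hs t).fun_inv (smoothedMax_pos hs t).ne'

theorem inv_smoothedMax_add_mul (hs : 0 < s) (t : ℝ) :
    (smoothedMax s t)⁻¹ + t * (-smoothedMaxDeriv s t / smoothedMax s t ^ 2)
      = (smoothedMax s t - t * smoothedMaxDeriv s t) / smoothedMax s t ^ 2 := by
  have := (smoothedMax_pos hs t).ne'
  field_simp
  ring

theorem inv_smoothedMax_le (hs : 0 < s) (t : ℝ) : (smoothedMax s t)⁻¹ ≤ s⁻¹ :=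
  inv_anti₀ hs (by linarith [le_smoothedMax hs t])

theorem abs_inv_smoothedMax_sub_le (hs : 0 < s) (x y : ℝ) :
    |(smoothedMax s x)⁻¹ - (smoothedMax s y)⁻¹| ≤ s⁻¹ ^ 2 * |x - y| := by
  have hx := smoothedMax_pos hs x
  have hy := smoothedMax_pos hs y
  have h : (smoothedMax s x)⁻¹ - (smoothedMax s y)⁻¹ =
      (smoothedMax s x)⁻¹ * (smoothedMax s y)⁻¹ * (smoothedMax s y - smoothedMax s x) := by
    field_simp
  rw [h, abs_mul, abs_of_pos (by positivity), abs_sub_comm, sq]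
  exact mul_le_mul (mul_le_mul (inv_smoothedMax_le hs x) (inv_smoothedMax_le hs y)
    (by positivity) (by positivity)) (abs_smoothedMax_sub_le hs x y) (abs_nonneg _) (by positivity)

theorem lipschitzWith_deriv_inv_smoothedMax (hs : 0 < s) :
    LipschitzWith (Real.toNNReal (4 * s⁻¹ ^ 3))
      fun t => -smoothedMaxDeriv s t / smoothedMax s t ^ 2 := by
  refine LipschitzWith.of_dist_le_mul fun x y => ?_
  rw [Real.coe_toNNReal _ (by positivity), Real.dist_eq, Real.dist_eq]
  have hx := inv_pos.2 (smoothedMax_pos hs x)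
  have hy := inv_pos.2 (smoothedMax_pos hs y)
  have hx' := inv_smoothedMax_le hs x
  have hy' := inv_smoothedMax_le hs y
  have hd := abs_inv_smoothedMax_sub_le hs x y
  have hD := abs_smoothedMaxDeriv_sub_le hs x y
  have hq := smoothedMaxDeriv_mem_Icc hs y
  simp only [div_eq_mul_inv, ← inv_pow] at hD ⊢
  set e := (smoothedMax s x)⁻¹
  set f := (smoothedMax s y)⁻¹
  set p := smoothedMaxDeriv s x
  set q := smoothedMaxDeriv s y
  calc |-p * e ^ 2 - -q * f ^ 2| = |(p - q) * e ^ 2 + q * (e + f) * (e - f)| := by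
        rw [← abs_neg]
        ring_nf
    _ ≤ |p - q| * e ^ 2 + q * (e + f) * |e - f| := by
        refine (abs_add_le _ _).trans_eq ?_
        rw [abs_mul, abs_mul, abs_of_nonneg (sq_nonneg e),
          abs_of_nonneg (mul_nonneg hq.1 (by positivity))]
    _ ≤ 2 * s⁻¹ * |x - y| * s⁻¹ ^ 2 + 1 * (s⁻¹ + s⁻¹) * (s⁻¹ ^ 2 * |x - y|) := by
        gcongr
        exact hq.2
    _ = 4 * s⁻¹ ^ 3 * |x - y| := by ring

end

/-- **Lemma A.1.**  For every `c > 0` there is a `C^{1,1}` function `d : [0,∞) → (0,∞)`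
(with derivative `D`, Lipschitz on `[0,∞)`) such that `d(t) + t d'(t) ≥ 0` for all `t > 0`,
`d(t) = 1/t` for `t > c/2`, `d ≡ d(0)` near `0`, and `d(t) + t d'(t) > 0` near `0`. -/
theorem exists_auxiliary_function_d (c : ℝ) (hc : 0 < c) :
    ∃ (d D : ℝ → ℝ) (K : NNReal),
      (∀ t ∈ Ici (0 : ℝ), 0 < d t) ∧
      (∀ t ∈ Ici (0 : ℝ), HasDerivWithinAt d (D t) (Ici 0) t) ∧
      LipschitzOnWith K D (Ici 0) ∧
      (∀ t : ℝ, 0 < t → 0 ≤ d t + t * D t) ∧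
      (∀ t : ℝ, c / 2 < t → d t = 1 / t) ∧
      (∃ ε : ℝ, 0 < ε ∧ ∀ t ∈ Icc (0 : ℝ) ε, d t = d 0) ∧
      (∃ ε' : ℝ, 0 < ε' ∧ ∀ t ∈ Icc (0 : ℝ) ε', 0 < d t + t * D t) := by
  have hs : 0 < c / 4 := by positivity
  refine ⟨fun t => (smoothedMax (c / 4) t)⁻¹,
    fun t => -smoothedMaxDeriv (c / 4) t / smoothedMax (c / 4) t ^ 2, _,
    fun t _ => inv_pos.2 (smoothedMax_pos hs t),
    fun t _ => (hasDerivAt_inv_smoothedMax hs t).hasDerivWithinAt,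
    (lipschitzWith_deriv_inv_smoothedMax hs).lipschitzOnWith, fun t _ => ?_, fun t ht => ?_,
    ⟨c / 4, hs, fun t ht => ?_⟩, ⟨c / 4, hs, fun t ht => ?_⟩⟩
  · rw [inv_smoothedMax_add_mul hs]
    exact div_nonneg (sub_nonneg.2 (mul_smoothedMaxDeriv_le hs t)) (sq_nonneg _)
  · simp only [smoothedMax_of_ge hs (show 2 * (c / 4) ≤ t by linarith), one_div]
  · simp only [smoothedMax_of_le hs ht.2, smoothedMax_of_le hs hs.le]
  · have h := smoothedMax_pos hs t
    simpa [smoothedMaxDeriv_of_le hs ht.2] using h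
end
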